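/- arXiv:2401.02006 — 4 statements merged into one kernel-verified Lean document; each statement's English description precedes it below -/
import Mathlib

section
/- Let R be a commutative noetherian ring, let f : R → A be a flat ring homomorphism (i.e. A is flat as an R-module), and let M be an A-module. Assume that M is flat as an R-module and that for every prime ideal p of R, the (A ⊗_R k(p))-module M ⊗_R k(p) is flat. Then M is flat as an A-module. -/
universe u

open Function TensorProduct

/-- If `0 → K → F → M → 0` is a flat presentation with `C ⊗ K → C ⊗ F` injective (that is,
`Tor₁(C, M) = 0`), then `- ⊗ M` preserves injectivity of maps with cokernel `C`. -/
lemma LinearMap.rTensor_injective_of_lTensor_injective {A K F M N' N C : Type*} [CommRing A]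
    [AddCommGroup K] [Module A K] [AddCommGroup F] [Module A F] [AddCommGroup M] [Module A M]
    [AddCommGroup N'] [Module A N'] [AddCommGroup N] [Module A N] [AddCommGroup C] [Module A C]
    [Module.Flat A F] {g : K →ₗ[A] F} {f : F →ₗ[A] M} (hgf : Exact g f) (hf : Surjective f)
    {i : N' →ₗ[A] N} {q : N →ₗ[A] C} (hi : Injective i) (hiq : Exact i q) (hq : Surjective q)
    (h : Injective (g.lTensor C)) : Injective (i.rTensor M) := by
  have := SnakeLemma.exact_δ'_left (g.lTensor N') (g.lTensor N) (g.lTensor C)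
    (i.rTensor K) (q.rTensor K) (rTensor_exact K hiq hq) (i.rTensor F) (q.rTensor F)
    (rTensor_exact F hiq hq) (by simp) (by simp) (K₃ := Unit) 0
    (by simpa using h)
    (f.lTensor N') (lTensor_exact _ hgf hf) (f.lTensor N)
    (lTensor_exact _ hgf hf) (rTensor_surjective K hq)
    (Module.Flat.rTensor_preserves_injective_linearMap _ hi) (i.rTensor M)
    (by simp) (lTensor_surjective _ hf)
  rw [Subsingleton.elim (SnakeLemma.δ' ..) 0] at this
  simpa using this

/-- If `N' → N → C → 0` is exact with `N' → N` injective and `F` is flat, then injectivity of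
`- ⊗ K → - ⊗ F` for `N'` and `C` implies it for `N`. -/
lemma LinearMap.lTensor_injective_of_extension {A K F N' N C : Type*} [CommRing A]
    [AddCommGroup K] [Module A K] [AddCommGroup F] [Module A F]
    [AddCommGroup N'] [Module A N'] [AddCommGroup N] [Module A N] [AddCommGroup C] [Module A C]
    [Module.Flat A F] {g : K →ₗ[A] F}
    {i : N' →ₗ[A] N} {q : N →ₗ[A] C} (hi : Injective i) (hiq : Exact i q) (hq : Surjective q)
    (h' : Injective (g.lTensor N')) (h : Injective (g.lTensor C)) : Injective (g.lTensor N) := by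
  rw [injective_iff_map_eq_zero]
  intro x hx
  obtain ⟨y, rfl⟩ := (rTensor_exact K hiq hq x).1 <| h <| by
    rw [map_zero, ← LinearMap.comp_apply, lTensor_comp_rTensor, ← rTensor_comp_lTensor,
      LinearMap.comp_apply, hx, map_zero]
  rw [← LinearMap.comp_apply, lTensor_comp_rTensor, ← rTensor_comp_lTensor,
    LinearMap.comp_apply] at hx
  rw [h' ((Module.Flat.rTensor_preserves_injective_linearMap (M := F) i hi)
    (hx.trans (map_zero _).symm) |>.trans (map_zero _).symm), map_zero]

/-- The kernel of a surjection between flat modules is flat. -/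
lemma Module.Flat.of_exact_of_flat {A K F M : Type*} [CommRing A]
    [AddCommGroup K] [Module A K] [AddCommGroup F] [Module A F] [AddCommGroup M] [Module A M]
    [Module.Flat A F] [Module.Flat A M] {g : K →ₗ[A] F} {f : F →ₗ[A] M} (hg : Function.Injective g)
    (hgf : Exact g f) (hf : Surjective f) : Module.Flat A K := by
  refine Module.Flat.iff_rTensor_injective'.2 fun I => ?_
  have h : Function.Injective (g.lTensor A ∘ₗ I.subtype.rTensor K) := by
    rw [LinearMap.lTensor_comp_rTensor, ← LinearMap.rTensor_comp_lTensor, LinearMap.coe_comp]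
    exact (rTensor_preserves_injective_linearMap _ I.injective_subtype).comp
      (LinearMap.lTensor_injective_of_exact_of_flat f hf g hg hgf I)
  rw [LinearMap.coe_comp] at h
  exact h.of_comp

/-- Injectivity of `N ⊗ K → N ⊗ F` can be checked on the finitely generated submodules of `N`
when `F` is flat. -/
lemma LinearMap.lTensor_injective_of_forall_finite {A K F N : Type*} [CommRing A]
    [AddCommGroup K] [Module A K] [AddCommGroup F] [Module A F] [AddCommGroup N] [Module A N]
    [Module.Flat A F] {g : K →ₗ[A] F}
    (h : ∀ N' : Submodule A N, N'.FG → Injective (g.lTensor N')) : Injective (g.lTensor N) := by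
  rw [injective_iff_map_eq_zero]
  intro x hx
  obtain ⟨N', hN', hsub⟩ :=
    TensorProduct.exists_finite_submodule_left_of_setFinite {x} (Set.finite_singleton x)
  obtain ⟨y, rfl⟩ := hsub rfl
  rw [← LinearMap.comp_apply, lTensor_comp_rTensor, ← rTensor_comp_lTensor,
    LinearMap.comp_apply] at hx
  rw [h N' (Module.Finite.iff_fg.1 hN')
    ((Module.Flat.rTensor_preserves_injective_linearMap (M := F) _ N'.injective_subtype)
    (hx.trans (map_zero _).symm) |>.trans (map_zero _).symm), map_zero]

/-- If `K → F → M → 0` becomes a short exact sequence with flat cokernel after base change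
to `B`, then `L ⊗ K → L ⊗ F` is injective for every `B`-module `L`. -/
lemma LinearMap.lTensor_injective_of_flat_baseChange {A B K F M L : Type*} [CommRing A]
    [CommRing B] [Algebra A B]
    [AddCommGroup K] [Module A K] [AddCommGroup F] [Module A F] [AddCommGroup M] [Module A M]
    [AddCommGroup L] [Module A L] [Module B L] [IsScalarTower A B L]
    [Module.Flat B (B ⊗[A] M)] {g : K →ₗ[A] F} {f : F →ₗ[A] M}
    (hgf : Exact g f) (hf : Surjective f) (hB : Injective (g.baseChange B)) :
    Injective (g.lTensor L) := by
  have h := LinearMap.lTensor_injective_of_exact_of_flat (f.baseChange B)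
    (lTensor_surjective B hf) (g.baseChange B) hB (lTensor_exact B hgf hf) L
  have e := congrArg (fun φ : L ⊗[B] (B ⊗[A] K) →ₗ[B] L ⊗[A] F => (φ : _ → _))
    (AlgebraTensorModule.lTensor_comp_cancelBaseChange (R := A) (A := B) (B := B) (M := L) g)
  have h2 : Injective (g.lTensor L ∘ AlgebraTensorModule.cancelBaseChange A B B L K) := by
    refine Eq.mpr (congrArg Injective e) ?_
    exact (AlgebraTensorModule.cancelBaseChange A B B L F).injective.comp h
  exact (Injective.of_comp_iff' _
    (AlgebraTensorModule.cancelBaseChange A B B L K).bijective).1 h2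

/-- If `0 → K → F → M → 0` is an exact sequence of `A`-modules with `M` flat over `R`, then it
stays exact on the left after base change along `A → A ⊗[R] S`. -/
lemma LinearMap.baseChange_injective_of_flat {R A K F M : Type*} (S : Type*) [CommRing R]
    [CommRing A] [Algebra R A] [CommRing S] [Algebra R S]
    [AddCommGroup K] [Module A K] [Module R K] [IsScalarTower R A K]
    [AddCommGroup F] [Module A F] [Module R F] [IsScalarTower R A F]
    [AddCommGroup M] [Module A M] [Module R M] [IsScalarTower R A M] [Module.Flat R M]
    {g : K →ₗ[A] F} {f : F →ₗ[A] M} (hg : Injective g) (hgf : Exact g f) (hf : Surjective f) :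
    Injective (g.baseChange (A ⊗[R] S)) := by
  have h : Injective ((g.restrictScalars R).rTensor S) :=
    (LinearMap.lTensor_inj_iff_rTensor_inj _ _).1
      (LinearMap.lTensor_injective_of_exact_of_flat (f.restrictScalars R) hf
        (g.restrictScalars R) hg hgf S)
  refine (LinearMap.lTensor_inj_iff_rTensor_inj _ _).2 ?_
  let eK := AlgebraTensorModule.cancelBaseChange R A A K S
  let eF := AlgebraTensorModule.cancelBaseChange R A A F S
  have e : ∀ x, eF (g.rTensor (A ⊗[R] S) x) = (g.restrictScalars R).rTensor S (eK x) := by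
    intro x
    induction x with
    | zero => simp
    | add x y hx hy => simp only [map_add, hx, hy]
    | tmul k b =>
      induction b with
      | zero => simp
      | add x y hx hy => simp only [map_add, tmul_add, hx, hy]
      | tmul a s => simp [eK, eF]
  refine Injective.of_comp (f := eF) ?_
  rw [show eF ∘ g.rTensor (A ⊗[R] S) = (g.restrictScalars R).rTensor S ∘ eK from funext e]
  exact h.comp eK.injective

section Fiber

variable {R A N : Type*} [CommRing R] [CommRing A] [Algebra R A] [AddCommGroup N] [Module A N]
  {p : Ideal R} [p.IsPrime]

lemma exists_smul_mem_range_mk_fiber (x : (A ⊗[R] FractionRing (R ⧸ p)) ⊗[A] N) :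
    ∃ r ∉ p, algebraMap R A r • x ∈
      LinearMap.range (TensorProduct.mk A (A ⊗[R] FractionRing (R ⧸ p)) N 1) := by
  induction x with
  | zero => exact ⟨1, p.one_notMem, by simp⟩
  | add x y hx hy =>
    obtain ⟨r, hr, hrx⟩ := hx
    obtain ⟨s, hs, hsy⟩ := hy
    refine ⟨s * r, ‹p.IsPrime›.mul_notMem hs hr, ?_⟩
    rw [map_mul, smul_add]
    refine Submodule.add_mem _ ?_ ?_
    · rw [mul_smul]
      exact Submodule.smul_mem _ _ hrx
    · rw [mul_comm, mul_smul]
      exact Submodule.smul_mem _ _ hsy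
  | tmul b n =>
    obtain ⟨r, hr, a, ha⟩ : ∃ r ∉ p, ∃ a : A,
        algebraMap R A r • b = algebraMap A (A ⊗[R] FractionRing (R ⧸ p)) a := by
      induction b with
      | zero => exact ⟨1, p.one_notMem, 0, by simp⟩
      | add x y hx hy =>
        obtain ⟨r, hr, a, ha⟩ := hx
        obtain ⟨s, hs, b, hb⟩ := hy
        refine ⟨s * r, ‹p.IsPrime›.mul_notMem hs hr,
          algebraMap R A s * a + algebraMap R A r * b, ?_⟩
        rw [map_mul, smul_add, mul_smul, ha, mul_comm, mul_smul, hb]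
        simp only [Algebra.algebraMap_eq_smul_one, add_smul, mul_smul]
      | tmul a z =>
        obtain ⟨⟨c, d⟩, hcd⟩ := IsLocalization.surj (nonZeroDivisors (R ⧸ p)) z
        obtain ⟨c, rfl⟩ := Ideal.Quotient.mk_surjective c
        obtain ⟨d, hd⟩ := d
        obtain ⟨d, rfl⟩ := Ideal.Quotient.mk_surjective d
        refine ⟨d, fun h => nonZeroDivisors.ne_zero hd (Ideal.Quotient.eq_zero_iff_mem.2 h),
          algebraMap R A c * a, ?_⟩
        have : d • z = c • (1 : FractionRing (R ⧸ p)) := by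
          rw [Algebra.smul_def, Algebra.smul_def, mul_one, mul_comm]
          exact hcd
        rw [algebraMap_smul, ← tmul_smul, this, tmul_smul, smul_tmul', Algebra.smul_def]
        rfl
    refine ⟨r, hr, a • n, ?_⟩
    rw [smul_tmul', ha, mk_apply, tmul_smul, smul_tmul', Algebra.algebraMap_eq_smul_one]

lemma exists_smul_eq_zero_of_mk_fiber_eq_zero (hN : ∀ r ∈ p, ∀ n : N, algebraMap R A r • n = 0)
    {n : N} (hn : (1 : A ⊗[R] FractionRing (R ⧸ p)) ⊗ₜ[A] n = 0) :
    ∃ r ∉ p, algebraMap R A r • n = 0 := by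
  let _ : Module R N := Module.compHom N (algebraMap R A)
  have : IsScalarTower R A N := .of_algebraMap_smul fun _ _ => rfl
  have h1 : n ⊗ₜ[R] (1 : FractionRing (R ⧸ p)) = 0 := by
    have := congrArg (AlgebraTensorModule.cancelBaseChange R A A N (FractionRing (R ⧸ p)))
      (congrArg (TensorProduct.comm A _ N) hn)
    simpa [Algebra.TensorProduct.one_def] using this
  have h2 : (1 : FractionRing (R ⧸ p)) ⊗ₜ[R ⧸ p] ((1 : R ⧸ p) ⊗ₜ[R] n) = 0 := by
    apply (AlgebraTensorModule.cancelBaseChange R (R ⧸ p) (R ⧸ p) (FractionRing (R ⧸ p)) N).injective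
    simpa using congrArg (TensorProduct.comm R N _) h1
  obtain ⟨⟨d, hd⟩, h3⟩ := (IsLocalizedModule.eq_zero_iff (nonZeroDivisors (R ⧸ p))
    (TensorProduct.mk (R ⧸ p) (FractionRing (R ⧸ p)) ((R ⧸ p) ⊗[R] N) 1)).1 h2
  obtain ⟨r, rfl⟩ := Ideal.Quotient.mk_surjective d
  refine ⟨r, fun h => nonZeroDivisors.ne_zero hd (Ideal.Quotient.eq_zero_iff_mem.2 h), ?_⟩
  have h4 : (1 : R ⧸ p) ⊗ₜ[R] (r • n) = 0 := by
    rw [tmul_smul]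
    exact h3
  have h5 : (Submodule.Quotient.mk (r • n) : N ⧸ (p • ⊤ : Submodule R N)) = 0 := by
    simpa using congrArg (quotTensorEquivQuotSMul N p) h4
  rw [Submodule.Quotient.mk_eq_zero] at h5
  have hbot : (p • ⊤ : Submodule R N) = ⊥ :=
    le_bot_iff.1 (Submodule.smul_le.2 fun r hr n _ => hN r hr n)
  rw [hbot] at h5
  exact h5

end Fiber

/-- The first syzygy of `M`: the kernel of the canonical surjection `(M →₀ A) → M`. -/
noncomputable abbrev Module.syzygy (A M : Type*) [CommRing A] [AddCommGroup M] [Module A M] :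
    Submodule A (M →₀ A) :=
  LinearMap.ker (Finsupp.linearCombination A (id : M → M))

/-- `Tor₁(N, M) = 0`, expressed through the canonical free presentation of `M`. -/
def Module.TorOneVanishes (A N M : Type*) [CommRing A] [AddCommGroup N] [Module A N]
    [AddCommGroup M] [Module A M] : Prop :=
  Function.Injective ((Module.syzygy A M).subtype.lTensor N)

/-- `M` is flat over `R` with flat fibers over `A`. -/
structure Module.FiberFlat (R A M : Type*) [CommRing R] [CommRing A] [Algebra R A]
    [AddCommGroup M] [Module R M] [Module A M] : Prop where
  flat : Module.Flat R M
  fiber_flat : ∀ (p : Ideal R) [p.IsPrime],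
    Module.Flat (A ⊗[R] FractionRing (R ⧸ p)) ((A ⊗[R] FractionRing (R ⧸ p)) ⊗[A] M)

namespace Module

lemma exact_syzygy (A M : Type*) [CommRing A] [AddCommGroup M] [Module A M] :
    Exact (syzygy A M).subtype (Finsupp.linearCombination A (id : M → M)) :=
  LinearMap.exact_subtype_ker_map _

lemma surjective_linearCombination_id (A M : Type*) [CommRing A] [AddCommGroup M] [Module A M] :
    Surjective (Finsupp.linearCombination A (id : M → M)) :=
  Finsupp.linearCombination_surjective _ surjective_id

lemma TorOneVanishes.rTensor_injective {A M N' N C : Type*} [CommRing A]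
    [AddCommGroup M] [Module A M] [AddCommGroup N'] [Module A N'] [AddCommGroup N] [Module A N]
    [AddCommGroup C] [Module A C] (h : TorOneVanishes A C M)
    {i : N' →ₗ[A] N} {q : N →ₗ[A] C} (hi : Function.Injective i) (hiq : Exact i q)
    (hq : Surjective q) : Function.Injective (i.rTensor M) :=
  LinearMap.rTensor_injective_of_lTensor_injective (K := syzygy A M) (F := M →₀ A)
    (exact_syzygy A M)
    (surjective_linearCombination_id A M) hi hiq hq h

lemma TorOneVanishes.of_submodule {A M N : Type*} [CommRing A]
    [AddCommGroup M] [Module A M] [AddCommGroup N] [Module A N] (N' : Submodule A N)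
    (h' : TorOneVanishes A N' M) (h : TorOneVanishes A (N ⧸ N') M) : TorOneVanishes A N M :=
  LinearMap.lTensor_injective_of_extension (K := syzygy A M) (F := M →₀ A) N'.injective_subtype
    (LinearMap.exact_subtype_mkQ N') N'.mkQ_surjective h' h

lemma TorOneVanishes.of_linearMap {A M N L : Type*} [CommRing A]
    [AddCommGroup M] [Module A M] [AddCommGroup N] [Module A N] [AddCommGroup L] [Module A L]
    (u : N →ₗ[A] L) (hker : TorOneVanishes A (LinearMap.ker u) M) (hL : TorOneVanishes A L M)
    (hcoker : TorOneVanishes A (L ⧸ LinearMap.range u) (syzygy A M)) : TorOneVanishes A N M := by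
  refine hker.of_submodule (LinearMap.ker u) ?_
  let v : (N ⧸ LinearMap.ker u) →ₗ[A] L :=
    (LinearMap.range u).subtype ∘ₗ u.quotKerEquivRange.toLinearMap
  have hv : Function.Injective v :=
    (LinearMap.range u).injective_subtype.comp u.quotKerEquivRange.injective
  have hexact : Exact v (LinearMap.range u).mkQ := by
    rw [LinearMap.exact_iff, Submodule.ker_mkQ, LinearMap.range_comp, LinearEquiv.range,
      Submodule.map_top, Submodule.range_subtype]
  have h := hL.comp (hcoker.rTensor_injective hv hexact (Submodule.mkQ_surjective _))
  rw [← LinearMap.coe_comp, LinearMap.lTensor_comp_rTensor, ← LinearMap.rTensor_comp_lTensor,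
    LinearMap.coe_comp] at h
  exact h.of_comp

namespace FiberFlat

section Exact

variable {R A K F M : Type*} [CommRing R] [CommRing A] [Algebra R A]
  [AddCommGroup K] [Module A K] [Module R K] [IsScalarTower R A K]
  [AddCommGroup F] [Module A F] [Module R F] [IsScalarTower R A F]
  [AddCommGroup M] [Module A M] [Module R M] [IsScalarTower R A M]
  {g : K →ₗ[A] F} {f : F →ₗ[A] M}

/-- The class of `A`-modules that are flat over `R` with flat fibers is closed under kernels of
surjections from flat `A`-modules. -/
lemma of_exact [Module.Flat R A] [Module.Flat A F] (h : FiberFlat R A M) (hg : Function.Injective g)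
    (hgf : Exact g f) (hf : Surjective f) : FiberFlat R A K where
  flat := by
    have := h.flat
    have : Module.Flat R F := .trans R A F
    exact Module.Flat.of_exact_of_flat (g := g.restrictScalars R) (f := f.restrictScalars R)
      hg hgf hf
  fiber_flat p _ := by
    have := h.flat
    have := h.fiber_flat p
    exact Module.Flat.of_exact_of_flat (K := (A ⊗[R] FractionRing (R ⧸ p)) ⊗[A] K)
      (F := (A ⊗[R] FractionRing (R ⧸ p)) ⊗[A] F) (M := (A ⊗[R] FractionRing (R ⧸ p)) ⊗[A] M)
      (LinearMap.baseChange_injective_of_flat _ hg hgf hf)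
      (f := f.baseChange (A ⊗[R] FractionRing (R ⧸ p)))
      (lTensor_exact _ hgf hf) (LinearMap.lTensor_surjective _ hf)

/-- A presentation of `M` stays injective after tensoring with a fiber module. -/
lemma lTensor_injective (h : FiberFlat R A M) (hg : Function.Injective g)
    (hgf : Exact g f) (hf : Surjective f) (p : Ideal R) [p.IsPrime]
    (N : Type*) [AddCommGroup N] [Module A N] :
    Function.Injective (g.lTensor ((A ⊗[R] FractionRing (R ⧸ p)) ⊗[A] N)) :=
  have := h.flat
  have := h.fiber_flat p
  LinearMap.lTensor_injective_of_flat_baseChange (B := A ⊗[R] FractionRing (R ⧸ p))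
    (L := (A ⊗[R] FractionRing (R ⧸ p)) ⊗[A] N) hgf hf
    (LinearMap.baseChange_injective_of_flat _ hg hgf hf)

end Exact

variable {R A M : Type*} [CommRing R] [CommRing A] [Algebra R A]
  [AddCommGroup M] [Module R M] [Module A M] [IsScalarTower R A M]

lemma syzygy [Module.Flat R A] (h : FiberFlat R A M) : FiberFlat R A (Module.syzygy A M) :=
  h.of_exact (K := Module.syzygy A M) (F := M →₀ A) (Module.syzygy A M).injective_subtype
    (exact_syzygy A M) (surjective_linearCombination_id A M)

lemma torOneVanishes_fiber (h : FiberFlat R A M) (p : Ideal R) [p.IsPrime]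
    (N : Type*) [AddCommGroup N] [Module A N] :
    TorOneVanishes A ((A ⊗[R] FractionRing (R ⧸ p)) ⊗[A] N) M :=
  h.lTensor_injective (K := Module.syzygy A M) (F := M →₀ A) (Module.syzygy A M).injective_subtype
    (exact_syzygy A M) (surjective_linearCombination_id A M) p N

end FiberFlat

lemma sup_span_singleton_smul_eq_zero {R A N : Type*} [CommRing R] [CommRing A] [Algebra R A]
    [AddCommGroup N] [Module A N] {I : Ideal R} (hI : ∀ r ∈ I, ∀ n : N, algebraMap R A r • n = 0)
    {x : R} (hx : ∀ n : N, algebraMap R A x • n = 0) :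
    ∀ r ∈ I ⊔ Ideal.span {x}, ∀ n : N, algebraMap R A r • n = 0 := by
  have h : I ⊔ Ideal.span {x} ≤ (Module.annihilator A N).comap (algebraMap R A) :=
    sup_le (fun r hr => Module.mem_annihilator.2 (hI r hr))
      ((Ideal.span_singleton_le_iff_mem _).2 (Module.mem_annihilator.2 hx))
  exact fun r hr => Module.mem_annihilator.1 (h hr)

/-- A finitely generated submodule of a module all of whose elements are killed by elements of
`R` outside of the prime `p` is killed by a single such element. -/
lemma exists_notMem_smul_eq_zero_of_fg {R A N : Type*} [CommRing R] [CommRing A] [Algebra R A]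
    [AddCommGroup N] [Module A N] {p : Ideal R} [p.IsPrime]
    (h : ∀ n : N, ∃ r ∉ p, algebraMap R A r • n = 0) {N' : Submodule A N} (hN' : N'.FG) :
    ∃ r ∉ p, ∀ n ∈ N', algebraMap R A r • n = 0 := by
  induction N', hN' using Submodule.fg_induction with
  | singleton n =>
    obtain ⟨r, hr, hn⟩ := h n
    refine ⟨r, hr, fun m hm => ?_⟩
    obtain ⟨a, rfl⟩ := Submodule.mem_span_singleton.1 hm
    rw [smul_comm, hn, smul_zero]
  | sup N₁ N₂ _ _ h₁ h₂ =>
    obtain ⟨r, hr, hr'⟩ := h₁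
    obtain ⟨s, hs, hs'⟩ := h₂
    refine ⟨r * s, ‹p.IsPrime›.mul_notMem hr hs, fun n hn => ?_⟩
    obtain ⟨a, ha, b, hb, rfl⟩ := Submodule.mem_sup.1 hn
    rw [map_mul, smul_add, mul_smul _ _ b, hs' b hb, mul_comm, mul_smul, hr' a ha, smul_zero,
      smul_zero, add_zero]

lemma torOneVanishes_of_torsion {R A M N : Type u} [CommRing R] [CommRing A] [Algebra R A]
    [AddCommGroup M] [Module A M] [AddCommGroup N] [Module A N] {p : Ideal R} [p.IsPrime]
    (ih : ∀ J > p, ∀ (C : Type u) [AddCommGroup C] [Module A C],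
      (∀ r ∈ J, ∀ n : C, algebraMap R A r • n = 0) → TorOneVanishes A C M)
    (hN : ∀ r ∈ p, ∀ n : N, algebraMap R A r • n = 0)
    (h : ∀ n : N, ∃ r ∉ p, algebraMap R A r • n = 0) : TorOneVanishes A N M := by
  refine LinearMap.lTensor_injective_of_forall_finite (K := syzygy A M) (F := M →₀ A) fun N' hN' => ?_
  obtain ⟨r, hr, hr'⟩ := exists_notMem_smul_eq_zero_of_fg h hN'
  refine ih (p ⊔ Ideal.span {r}) (Submodule.lt_sup_iff_notMem.2 hr) N' ?_
  exact sup_span_singleton_smul_eq_zero (fun s hs n => Subtype.ext (hN s hs n))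
    fun n => Subtype.ext (hr' n n.2)

/-- If `N → L` has kernel and cokernel killed by `p` and torsion over `R ⧸ p`, then
`Tor₁(L, M) = 0` implies `Tor₁(N, M) = 0`, provided `Tor₁(-, M)` and `Tor₁(-, syzygy A M)` vanish
on modules killed by an ideal strictly larger than `p`. -/
lemma FiberFlat.torOneVanishes_of_linearMap {R A M N L : Type u} [CommRing R] [CommRing A]
    [Algebra R A] [Module.Flat R A]
    [AddCommGroup M] [Module R M] [Module A M] [IsScalarTower R A M] (hM : FiberFlat R A M)
    [AddCommGroup N] [Module A N] [AddCommGroup L] [Module A L] {p : Ideal R} [p.IsPrime]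
    (ih : ∀ J > p, ∀ (M : Type u) [AddCommGroup M] [Module R M] [Module A M] [IsScalarTower R A M],
      FiberFlat R A M → ∀ (C : Type u) [AddCommGroup C] [Module A C],
      (∀ r ∈ J, ∀ n : C, algebraMap R A r • n = 0) → TorOneVanishes A C M)
    (u : N →ₗ[A] L) (hL : TorOneVanishes A L M)
    (hN : ∀ r ∈ p, ∀ n : N, algebraMap R A r • n = 0)
    (hpL : ∀ r ∈ p, ∀ x : L, algebraMap R A r • x = 0)
    (hker : ∀ n, u n = 0 → ∃ r ∉ p, algebraMap R A r • n = 0)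
    (hcoker : ∀ x, ∃ r ∉ p, algebraMap R A r • x ∈ LinearMap.range u) : TorOneVanishes A N M := by
  refine .of_linearMap u ?_ hL ?_
  · refine torOneVanishes_of_torsion (p := p) (fun J hJ => ih J hJ M hM)
      (fun r hr n => Subtype.ext (hN r hr n)) fun n => ?_
    obtain ⟨r, hr, h⟩ := hker n n.2
    exact ⟨r, hr, Subtype.ext h⟩
  · refine torOneVanishes_of_torsion (p := p) (fun J hJ => ih J hJ _ hM.syzygy) ?_ ?_
    · rintro r hr ⟨x⟩
      exact congrArg (LinearMap.range u).mkQ (hpL r hr x)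
    · rintro ⟨x⟩
      obtain ⟨r, hr, h⟩ := hcoker x
      exact ⟨r, hr, (Submodule.Quotient.mk_eq_zero _).2 h⟩

theorem FiberFlat.torOneVanishes_of_isPrime {R A M N : Type u} [CommRing R] [CommRing A]
    [Algebra R A] [Module.Flat R A]
    [AddCommGroup M] [Module R M] [Module A M] [IsScalarTower R A M] (hM : FiberFlat R A M)
    [AddCommGroup N] [Module A N] {p : Ideal R} [p.IsPrime]
    (ih : ∀ J > p, ∀ (M : Type u) [AddCommGroup M] [Module R M] [Module A M] [IsScalarTower R A M],
      FiberFlat R A M → ∀ (C : Type u) [AddCommGroup C] [Module A C],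
      (∀ r ∈ J, ∀ n : C, algebraMap R A r • n = 0) → TorOneVanishes A C M)
    (hN : ∀ r ∈ p, ∀ n : N, algebraMap R A r • n = 0) : TorOneVanishes A N M := by
  refine hM.torOneVanishes_of_linearMap ih
    (TensorProduct.mk A (A ⊗[R] FractionRing (R ⧸ p)) N 1) (hM.torOneVanishes_fiber p N) hN ?_
    (fun n hn => exists_smul_eq_zero_of_mk_fiber_eq_zero hN hn) exists_smul_mem_range_mk_fiber
  intro r hr x
  induction x with
  | zero => exact smul_zero _
  | add x y hx hy => rw [smul_add, hx, hy, add_zero]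
  | tmul b n => rw [← tmul_smul, hN r hr, tmul_zero]

theorem FiberFlat.torOneVanishes {R A : Type u} [CommRing R] [IsNoetherianRing R] [CommRing A]
    [Algebra R A] [Module.Flat R A] (I : Ideal R) :
    ∀ (M : Type u) [AddCommGroup M] [Module R M] [Module A M] [IsScalarTower R A M],
      FiberFlat R A M → ∀ (N : Type u) [AddCommGroup N] [Module A N],
      (∀ r ∈ I, ∀ n : N, algebraMap R A r • n = 0) → TorOneVanishes A N M := by
  induction I using WellFoundedGT.induction with
  | ind I ih =>
  intro M _ _ _ _ hM N _ _ hN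
  by_cases hI : I.IsPrime
  · exact hM.torOneVanishes_of_isPrime ih hN
  obtain rfl | ⟨x, hx, y, hy, hxy⟩ := Ideal.not_isPrime_iff.1 hI
  · have : Subsingleton N := subsingleton_of_forall_eq 0 fun n => by simpa using hN 1 trivial n
    exact injective_of_subsingleton _
  · let N' := LinearMap.range (LinearMap.lsmul A N (algebraMap R A x))
    refine .of_submodule N' ?_ ?_
    · refine ih _ (Submodule.lt_sup_iff_notMem.2 hy) M hM N' (sup_span_singleton_smul_eq_zero
        (fun s hs n => Subtype.ext (hN s hs n)) ?_)
      rintro ⟨_, n, rfl⟩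
      refine Subtype.ext ?_
      change algebraMap R A y • algebraMap R A x • n = 0
      rw [smul_smul, ← map_mul, mul_comm, hN _ hxy]
    · refine ih _ (Submodule.lt_sup_iff_notMem.2 hx) M hM (N ⧸ N') (sup_span_singleton_smul_eq_zero
        ?_ ?_)
      · rintro s hs ⟨n⟩
        exact congrArg N'.mkQ (hN s hs n)
      · rintro ⟨n⟩
        exact (Submodule.Quotient.mk_eq_zero N').2 ⟨n, rfl⟩

theorem FiberFlat.flat_of_isNoetherianRing {R A M : Type u} [CommRing R] [IsNoetherianRing R]
    [CommRing A] [Algebra R A] [Module.Flat R A] [AddCommGroup M] [Module R M] [Module A M]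
    [IsScalarTower R A M] (hM : FiberFlat R A M) : Module.Flat A M := by
  refine Module.Flat.iff_rTensor_injective'.2 fun I => ?_
  have h : TorOneVanishes A (A ⧸ I) M := torOneVanishes (⊥ : Ideal R) M hM (A ⧸ I) fun r hr n => by
    rw [Ideal.mem_bot.1 hr, map_zero, zero_smul]
  exact h.rTensor_injective I.injective_subtype (LinearMap.exact_subtype_mkQ I) I.mkQ_surjective

end Module

theorem fiber_criterion_for_flatness
    (R A M : Type) [CommRing R] [IsNoetherianRing R] [CommRing A] [Algebra R A]
    [AddCommGroup M] [Module R M] [Module A M] [IsScalarTower R A M]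
    [Module.Flat R A] [Module.Flat R M]
    (fiber_flat : ∀ (p : Ideal R) [p.IsPrime],
      Module.Flat (A ⊗[R] FractionRing (R ⧸ p)) ((A ⊗[R] FractionRing (R ⧸ p)) ⊗[A] M)) :
    Module.Flat A M :=
  Module.FiberFlat.flat_of_isNoetherianRing ⟨‹_›, fiber_flat⟩
end

section
/- Let R be a commutative noetherian ring, let f : R → A be a flat ring homomorphism, and let M be an A-module. Assume that M is flat as an R-module and that for every prime ideal p of R, the (A ⊗_R k(p))-module M ⊗_R k(p) is faithfully flat. Then M is faithfully flat as an A-module. -/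
/-!
Corollary 3.3: if `R` is noetherian, `R → A` is a flat ring homomorphism, `M` is an `A`-module
which is flat over `R` and such that for every prime `p` of `R` the fiber `M ⊗_R k(p)` is
faithfully flat over `A ⊗_R k(p)`, then `M` is faithfully flat over `A`.
The fiber `M ⊗_R k(p)` with its `A ⊗_R k(p)`-module structure is (canonically) realized as the
base change `(A ⊗[R] k(p)) ⊗[A] M`, where `k(p) = Frac(R ⧸ p)`.
-/

set_option synthInstance.maxHeartbeats 1000000

open TensorProduct

section TorVanishing

universe uA uM

variable {A : Type uA} [CommRing A]
variable {K F : Type*} {M : Type uM} {N' N N'' : Type*}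
  [AddCommGroup K] [AddCommGroup F] [AddCommGroup M] [AddCommGroup N'] [AddCommGroup N] [AddCommGroup N''] [Module A K] [Module A F] [Module A M]
  [Module A N'] [Module A N] [Module A N'']

theorem LinearMap.rTensor_injective_of_lTensor_injective_s1 [Module.Flat A F]
    {f : K →ₗ[A] F} {g : F →ₗ[A] M} (hfg : Function.Exact f g) (hg : Function.Surjective g)
    {i : N' →ₗ[A] N} {q : N →ₗ[A] N''} (hi : Function.Injective i) (hiq : Function.Exact i q)
    (hq : Function.Surjective q) (h : Function.Injective (f.lTensor N'')) :
    Function.Injective (i.rTensor M) := by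
  rw [injective_iff_map_eq_zero]
  intro x hx
  obtain ⟨y, rfl⟩ := g.lTensor_surjective N' hg x
  have hy : g.lTensor N (i.rTensor F y) = 0 := by
    rwa [← LinearMap.comp_apply, LinearMap.lTensor_comp_rTensor, ← LinearMap.rTensor_comp_lTensor]
  obtain ⟨z, hz⟩ := (lTensor_exact N hfg hg _).mp hy
  have hz' : q.rTensor K z = 0 := by
    refine h ?_
    rw [← LinearMap.comp_apply, LinearMap.lTensor_comp_rTensor, ← LinearMap.rTensor_comp_lTensor,
      LinearMap.comp_apply, hz, map_zero]
    exact (rTensor_exact F hiq hq).apply_apply_eq_zero y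
  obtain ⟨w, rfl⟩ := (rTensor_exact K hiq hq _).mp hz'
  have hw : f.lTensor N' w = y := by
    refine Module.Flat.rTensor_preserves_injective_linearMap (M := F) i hi ?_
    rw [← hz, ← LinearMap.comp_apply, ← LinearMap.comp_apply, LinearMap.lTensor_comp_rTensor,
      LinearMap.rTensor_comp_lTensor]
  rw [← hw]
  exact (lTensor_exact N' hfg hg).apply_apply_eq_zero w

theorem LinearMap.lTensor_injective_of_exact [Module.Flat A F] {f : K →ₗ[A] F}
    {i : N' →ₗ[A] N} {q : N →ₗ[A] N''} (hi : Function.Injective i) (hiq : Function.Exact i q)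
    (hq : Function.Surjective q) (h' : Function.Injective (f.lTensor N'))
    (h'' : Function.Injective (f.lTensor N'')) : Function.Injective (f.lTensor N) := by
  rw [injective_iff_map_eq_zero]
  intro x hx
  have hx' : q.rTensor K x = 0 := by
    refine h'' ?_
    rw [← LinearMap.comp_apply, LinearMap.lTensor_comp_rTensor, ← LinearMap.rTensor_comp_lTensor,
      LinearMap.comp_apply, hx, map_zero, map_zero]
  obtain ⟨y, rfl⟩ := (rTensor_exact K hiq hq _).mp hx'
  have hy : y = 0 := by
    refine h' (Module.Flat.rTensor_preserves_injective_linearMap (M := F) i hi ?_)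
    rw [← LinearMap.comp_apply, LinearMap.lTensor_comp_rTensor,
      ← LinearMap.rTensor_comp_lTensor, LinearMap.comp_apply] at hx
    rw [hx, map_zero, map_zero]
  rw [hy, map_zero]

theorem LinearMap.lTensor_injective_of_rTensor_injective [Module.Flat A F] {f : K →ₗ[A] F}
    {i : N' →ₗ[A] N} (hi : Function.Injective (i.rTensor K))
    (h : Function.Injective (f.lTensor N)) : Function.Injective (f.lTensor N') := by
  have := h.comp hi
  rw [← LinearMap.coe_comp, LinearMap.lTensor_comp_rTensor, ← LinearMap.rTensor_comp_lTensor,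
    LinearMap.coe_comp] at this
  exact this.of_comp

theorem LinearMap.lTensor_injective_of_forall_fg [Module.Flat A F] {f : K →ₗ[A] F}
    (h : ∀ P : Submodule A N, P.FG → Function.Injective (f.lTensor P)) :
    Function.Injective (f.lTensor N) := by
  rw [injective_iff_map_eq_zero]
  intro x hx
  obtain ⟨P, hP, y, rfl⟩ := TensorProduct.exists_of_fg x
  have hy : y = 0 := by
    refine h P hP (Module.Flat.rTensor_preserves_injective_linearMap (M := F) P.subtype
      P.injective_subtype ?_)
    rw [← LinearMap.comp_apply, LinearMap.lTensor_comp_rTensor,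
      ← LinearMap.rTensor_comp_lTensor, LinearMap.comp_apply] at hx
    rw [hx, map_zero, map_zero]
  rw [hy, map_zero]

variable (A M) in
theorem Module.exists_free_presentation : ∃ (L G : Type (max uA uM)) (_ : AddCommGroup L)
    (_ : AddCommGroup G) (_ : Module A L) (_ : Module A G) (f : L →ₗ[A] G) (g : G →ₗ[A] M),
    Module.Free A G ∧ Function.Injective f ∧ Function.Exact f g ∧ Function.Surjective g :=
  ⟨LinearMap.ker (Finsupp.linearCombination A (id : M → M)), M →₀ A, inferInstance, inferInstance,
    inferInstance, inferInstance, Submodule.subtype _, Finsupp.linearCombination A (id : M → M),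
    inferInstance, Submodule.injective_subtype _, LinearMap.exact_subtype_ker_map _,
    Finsupp.linearCombination_id_surjective A M⟩

theorem LinearMap.lTensor_injective_of_flat [Module.Flat A M]
    {f : K →ₗ[A] F} {g : F →ₗ[A] M} (hf : Function.Injective f) (hfg : Function.Exact f g)
    (hg : Function.Surjective g) : Function.Injective (f.lTensor N) := by
  rw [LinearMap.lTensor_inj_iff_rTensor_inj]
  obtain ⟨L, G, _, _, _, _, i, q, _, hi, hiq, hq⟩ := Module.exists_free_presentation A N
  exact rTensor_injective_of_lTensor_injective_s1 hiq hq hf hfg hg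
    (Module.Flat.lTensor_preserves_injective_linearMap i hi)

theorem Module.Flat.of_exact [Module.Flat A F] [Module.Flat A M]
    {f : K →ₗ[A] F} {g : F →ₗ[A] M} (hf : Function.Injective f) (hfg : Function.Exact f g)
    (hg : Function.Surjective g) : Module.Flat A K := by
  refine Module.Flat.iff_rTensor_preserves_injective_linearMap.mpr fun N P _ _ _ _ i hi => ?_
  have h := (Module.Flat.rTensor_preserves_injective_linearMap (M := F) i hi).comp
    (LinearMap.lTensor_injective_of_flat (N := N) hf hfg hg)
  rw [← LinearMap.coe_comp, LinearMap.rTensor_comp_lTensor, ← LinearMap.lTensor_comp_rTensor,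
    LinearMap.coe_comp] at h
  exact h.of_comp

theorem LinearMap.lTensor_injective_of_baseChange {B X : Type*} [CommRing B] [Algebra A B]
    [AddCommGroup X] [Module A X] [Module B X] [IsScalarTower A B X] [Module.Flat B (B ⊗[A] M)]
    {f : K →ₗ[A] F} {g : F →ₗ[A] M} (hf : Function.Injective (f.lTensor B))
    (hfg : Function.Exact f g) (hg : Function.Surjective g) :
    Function.Injective (f.lTensor X) := by
  have h : Function.Injective ((f.baseChange B).lTensor X) :=
    lTensor_injective_of_flat (g := g.baseChange B) hf (lTensor_exact B hfg hg)
      (g.lTensor_surjective B hg)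
  let eK := TensorProduct.AlgebraTensorModule.cancelBaseChange A B B X K
  let eF := TensorProduct.AlgebraTensorModule.cancelBaseChange A B B X F
  have hcomm : ∀ x, f.lTensor X (eK x) = eF ((f.baseChange B).lTensor X x) := by
    intro x
    induction x with
    | zero => simp
    | add x y hx hy => simp [hx, hy]
    | tmul x y =>
      induction y with
      | zero => simp
      | add y z hy hz => simp [tmul_add, hy, hz]
      | tmul b k => simp [eK, eF]
  intro x y hxy
  obtain ⟨x, rfl⟩ := eK.surjective x
  obtain ⟨y, rfl⟩ := eK.surjective y
  rw [hcomm, hcomm] at hxy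
  rw [h (eF.injective hxy)]

theorem LinearMap.lTensor_tensorProduct_injective {R L : Type*} [CommRing R] [Algebra R A]
    [AddCommGroup L] [Module R L] [Module R K] [IsScalarTower R A K]
    [Module R F] [IsScalarTower R A F] {f : K →ₗ[A] F}
    (hf : Function.Injective ((f.restrictScalars R).lTensor L)) :
    Function.Injective (f.lTensor (A ⊗[R] L)) := by
  rw [LinearMap.lTensor_inj_iff_rTensor_inj] at hf ⊢
  let eK := TensorProduct.AlgebraTensorModule.cancelBaseChange R A A K L
  let eF := TensorProduct.AlgebraTensorModule.cancelBaseChange R A A F L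
  have hcomm : ∀ x, (f.restrictScalars R).rTensor L (eK x) = eF (f.rTensor _ x) := by
    intro x
    induction x with
    | zero => simp
    | add x y hx hy => simp [hx, hy]
    | tmul x y =>
      induction y with
      | zero => simp
      | add y z hy hz => simp [tmul_add, hy, hz]
      | tmul b k => simp [eK, eF]
  intro x y hxy
  have := congrArg eF hxy
  rw [← hcomm, ← hcomm] at this
  exact eK.injective (hf this)

end TorVanishing

section Fiberwise

universe u

variable (R A : Type u) [CommRing R] [CommRing A] [Algebra R A]

section FiberField

variable {R} (p : Ideal R) [p.IsPrime]

/-- The residue field `k(p)` of `R` at the prime ideal `p`. -/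
def FiberField : Type u := FractionRing (R ⧸ p)

noncomputable instance : Field (FiberField p) := inferInstanceAs (Field (FractionRing (R ⧸ p)))

noncomputable instance : Algebra (R ⧸ p) (FiberField p) :=
  inferInstanceAs (Algebra (R ⧸ p) (FractionRing (R ⧸ p)))

noncomputable instance : Algebra R (FiberField p) :=
  inferInstanceAs (Algebra R (FractionRing (R ⧸ p)))

instance : IsScalarTower R (R ⧸ p) (FiberField p) :=
  inferInstanceAs (IsScalarTower R (R ⧸ p) (FractionRing (R ⧸ p)))

instance : IsFractionRing (R ⧸ p) (FiberField p) :=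
  inferInstanceAs (IsFractionRing (R ⧸ p) (FractionRing (R ⧸ p)))

end FiberField

/-- The fiber `A ⊗[R] k(p)` of `A` over the prime ideal `p` of `R`. -/
abbrev FiberRing (p : Ideal R) [p.IsPrime] : Type u := A ⊗[R] FiberField p

/-- An `A`-module is fiberwise flat over `R` if it is flat over `R` and all of its fibers over
prime ideals `p` of `R` are flat over `A ⊗[R] k(p)`. -/
structure IsFiberwiseFlat (M : Type u) [AddCommGroup M] [Module R M] [Module A M] : Prop where
  flat : Module.Flat R M
  flat_fiber (p : Ideal R) [p.IsPrime] : Module.Flat (FiberRing R A p) (FiberRing R A p ⊗[A] M)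

/-- Tensoring with `N` preserves injectivity of the first map of every flat presentation of a
fiberwise flat module `M`; in other words, the first Tor of `M` and `N` vanishes. -/
def IsFiberwiseAcyclic (N : Type u) [AddCommGroup N] [Module A N] : Prop :=
  ∀ (K F M : Type u) [AddCommGroup K] [AddCommGroup F] [AddCommGroup M]
    [Module A K] [Module A F] [Module A M] [Module R K] [Module R F] [Module R M]
    [IsScalarTower R A K] [IsScalarTower R A F] [IsScalarTower R A M] [Module.Flat A F]
    (f : K →ₗ[A] F) (g : F →ₗ[A] M), Function.Injective f → Function.Exact f g →
    Function.Surjective g → IsFiberwiseFlat R A M → Function.Injective (f.lTensor N)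

variable {R A}

section

variable {K F M : Type u} [AddCommGroup K] [AddCommGroup F] [AddCommGroup M]
    [Module A K] [Module A F] [Module A M] [Module R K] [Module R F] [Module R M]
    [IsScalarTower R A K] [IsScalarTower R A F] [IsScalarTower R A M]
    {f : K →ₗ[A] F} {g : F →ₗ[A] M}

theorem IsFiberwiseFlat.lTensor_fiberRing_injective (hM : IsFiberwiseFlat R A M)
    (hf : Function.Injective f) (hfg : Function.Exact f g) (hg : Function.Surjective g)
    (p : Ideal R) [p.IsPrime] : Function.Injective (f.lTensor (FiberRing R A p)) := by
  have := hM.flat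
  exact LinearMap.lTensor_tensorProduct_injective (LinearMap.lTensor_injective_of_flat
    (f := f.restrictScalars R) (g := g.restrictScalars R) hf hfg hg)

theorem IsFiberwiseFlat.of_exact [Module.Flat R A] [Module.Flat A F] (hM : IsFiberwiseFlat R A M)
    (hf : Function.Injective f) (hfg : Function.Exact f g) (hg : Function.Surjective g) :
    IsFiberwiseFlat R A K where
  flat := by
    have := hM.flat
    have : Module.Flat R F := Module.Flat.trans R A F
    exact Module.Flat.of_exact (f := f.restrictScalars R) (g := g.restrictScalars R) hf hfg hg
  flat_fiber p _ := by
    have := hM.flat_fiber p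
    exact Module.Flat.of_exact (f := f.baseChange (FiberRing R A p))
      (g := g.baseChange (FiberRing R A p)) (hM.lTensor_fiberRing_injective hf hfg hg p)
      (lTensor_exact _ hfg hg) (g.lTensor_surjective _ hg)

end

namespace IsFiberwiseAcyclic

variable {N' N N'' : Type u} [AddCommGroup N'] [AddCommGroup N] [AddCommGroup N'']
  [Module A N'] [Module A N] [Module A N''] {i : N' →ₗ[A] N} {q : N →ₗ[A] N''}

theorem of_exact (hi : Function.Injective i) (hiq : Function.Exact i q)
    (hq : Function.Surjective q) (h' : IsFiberwiseAcyclic R A N')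
    (h'' : IsFiberwiseAcyclic R A N'') : IsFiberwiseAcyclic R A N :=
  fun K F M _ _ _ _ _ _ _ _ _ _ _ _ _ f g hf hfg hg hM =>
    LinearMap.lTensor_injective_of_exact hi hiq hq (h' K F M f g hf hfg hg hM)
      (h'' K F M f g hf hfg hg hM)

theorem rTensor_injective (hi : Function.Injective i) (hiq : Function.Exact i q)
    (hq : Function.Surjective q) (h'' : IsFiberwiseAcyclic R A N'') {M : Type u} [AddCommGroup M]
    [Module A M] [Module R M] [IsScalarTower R A M] (hM : IsFiberwiseFlat R A M) :
    Function.Injective (i.rTensor M) := by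
  obtain ⟨L, G, _, _, _, _, f, g, _, hf, hfg, hg⟩ := Module.exists_free_presentation A M
  let _ : Module R L := Module.compHom L (algebraMap R A)
  let _ : Module R G := Module.compHom G (algebraMap R A)
  have : IsScalarTower R A L := .of_algebraMap_smul fun _ _ => rfl
  have : IsScalarTower R A G := .of_algebraMap_smul fun _ _ => rfl
  exact LinearMap.rTensor_injective_of_lTensor_injective_s1 hfg hg hi hiq hq
    (h'' L G M f g hf hfg hg hM)

theorem left_of_exact [Module.Flat R A] (hi : Function.Injective i) (hiq : Function.Exact i q)
    (hq : Function.Surjective q) (h : IsFiberwiseAcyclic R A N)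
    (h'' : IsFiberwiseAcyclic R A N'') : IsFiberwiseAcyclic R A N' :=
  fun K F M _ _ _ _ _ _ _ _ _ _ _ _ _ f g hf hfg hg hM =>
    LinearMap.lTensor_injective_of_rTensor_injective
      (h''.rTensor_injective hi hiq hq (hM.of_exact hf hfg hg)) (h K F M f g hf hfg hg hM)

theorem of_forall_fg (h : ∀ P : Submodule A N, P.FG → IsFiberwiseAcyclic R A P) :
    IsFiberwiseAcyclic R A N :=
  fun K F M _ _ _ _ _ _ _ _ _ _ _ _ _ f g hf hfg hg hM =>
    LinearMap.lTensor_injective_of_forall_fg fun P hP => h P hP K F M f g hf hfg hg hM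

theorem of_fiberRing (p : Ideal R) [p.IsPrime] [Module (FiberRing R A p) N]
    [IsScalarTower A (FiberRing R A p) N] : IsFiberwiseAcyclic R A N := by
  intro K F M _ _ _ _ _ _ _ _ _ _ _ _ _ f g hf hfg hg hM
  have := hM.flat_fiber p
  exact LinearMap.lTensor_injective_of_baseChange (B := FiberRing R A p)
    (hM.lTensor_fiberRing_injective hf hfg hg p) hfg hg

end IsFiberwiseAcyclic

variable {N : Type u} [AddCommGroup N] [Module A N]

theorem exists_smul_eq_zero_of_one_tmul_eq_zero {p : Ideal R} [p.IsPrime]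
    (hN : p ≤ (Module.annihilator A N).comap (algebraMap R A)) {n : N}
    (hn : (1 : FiberRing R A p) ⊗ₜ[A] n = 0) : ∃ s ∉ p, algebraMap R A s • n = 0 := by
  let _ : Module R N := Module.compHom N (algebraMap R A)
  have : IsScalarTower R A N := .of_algebraMap_smul fun _ _ => rfl
  have htors : Module.IsTorsionBySet R N p := fun n r =>
    Module.mem_annihilator.mp (hN r.2) n
  let _ : Module (R ⧸ p) N := htors.module
  have : IsScalarTower R (R ⧸ p) N := htors.isScalarTower
  let k := FiberField p
  have h₁ : n ⊗ₜ[R] (1 : k) = 0 := by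
    have h := congrArg (TensorProduct.AlgebraTensorModule.cancelBaseChange R A A N k)
      (congrArg (TensorProduct.comm A (FiberRing R A p) N) hn)
    simpa [Algebra.TensorProduct.one_def] using h
  have h₂ : (1 : k) ⊗ₜ[R ⧸ p] n = 0 := by
    have h := congrArg (TensorProduct.mapOfCompatibleSMul (R ⧸ p) R R N k) h₁
    have h' := congrArg (TensorProduct.comm (R ⧸ p) N k) h
    simpa using h'
  have : IsLocalizedModule (nonZeroDivisors (R ⧸ p)) (TensorProduct.mk (R ⧸ p) k N 1) :=
    (isLocalizedModule_iff_isBaseChange (nonZeroDivisors (R ⧸ p)) k _).mpr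
      (TensorProduct.isBaseChange (R ⧸ p) N k)
  obtain ⟨⟨s, hs⟩, hsn⟩ := (IsLocalizedModule.eq_zero_iff (nonZeroDivisors (R ⧸ p))
    (TensorProduct.mk (R ⧸ p) k N 1)).mp h₂
  obtain ⟨s, rfl⟩ := Ideal.Quotient.mk_surjective s
  refine ⟨s, fun h => nonZeroDivisors.ne_zero hs (Ideal.Quotient.eq_zero_iff_mem.mpr h), hsn⟩

theorem exists_smul_eq_one_tmul {p : Ideal R} [p.IsPrime] (x : FiberRing R A p ⊗[A] N) :
    ∃ s ∉ p, ∃ n : N, algebraMap R A s • x = (1 : FiberRing R A p) ⊗ₜ[A] n := by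
  induction x with
  | zero => exact ⟨1, p.one_notMem, 0, by simp⟩
  | add x y hx hy =>
    obtain ⟨s, hs, n, hn⟩ := hx
    obtain ⟨t, ht, m, hm⟩ := hy
    refine ⟨s * t, fun h => (‹p.IsPrime›.mem_or_mem h).elim hs ht,
      algebraMap R A t • n + algebraMap R A s • m, ?_⟩
    rw [tmul_add, tmul_smul, tmul_smul, ← hn, ← hm, smul_add, map_mul, mul_smul, mul_smul,
      smul_comm (algebraMap R A s) (algebraMap R A t) x]
  | tmul b n =>
    obtain ⟨s, hs, a, ha⟩ : ∃ s ∉ p, ∃ a : A, algebraMap R A s • b = a ⊗ₜ[R] 1 := by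
      induction b using TensorProduct.induction_on with
      | zero => exact ⟨1, p.one_notMem, 0, by simp⟩
      | add x y hx hy =>
        obtain ⟨s, hs, n, hn⟩ := hx
        obtain ⟨t, ht, m, hm⟩ := hy
        refine ⟨s * t, fun h => (‹p.IsPrime›.mem_or_mem h).elim hs ht,
          algebraMap R A t • n + algebraMap R A s • m, ?_⟩
        rw [add_tmul, ← smul_tmul', ← smul_tmul', ← hn, ← hm, smul_add, map_mul, mul_smul,
          mul_smul, smul_comm (algebraMap R A s) (algebraMap R A t) x]
      | tmul a c =>
        obtain ⟨⟨r, ⟨s, hs⟩⟩, h⟩ := IsLocalization.surj (nonZeroDivisors (R ⧸ p)) c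
        obtain ⟨s, rfl⟩ := Ideal.Quotient.mk_surjective s
        obtain ⟨r, rfl⟩ := Ideal.Quotient.mk_surjective r
        refine ⟨s, fun h => nonZeroDivisors.ne_zero hs (Ideal.Quotient.eq_zero_iff_mem.mpr h),
          r • a, ?_⟩
        have h' : s • c = r • (1 : FiberField p) := by
          rw [Algebra.smul_def, Algebra.smul_def, mul_one, mul_comm]
          exact h
        rw [algebraMap_smul, smul_tmul, ← h', tmul_smul]
    refine ⟨s, hs, a • n, ?_⟩
    rw [smul_tmul', ha, ← smul_tmul, Algebra.TensorProduct.one_def, smul_tmul', smul_eq_mul,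
      mul_one]

theorem Submodule.FG.exists_smul_eq_zero {p : Ideal R} [p.IsPrime]
    (hN : ∀ n : N, ∃ s ∉ p, algebraMap R A s • n = 0) {P : Submodule A N} (hP : P.FG) :
    ∃ s ∉ p, ∀ n ∈ P, algebraMap R A s • n = 0 := by
  induction P, hP using Submodule.fg_induction with
  | singleton x =>
    obtain ⟨s, hs, hx⟩ := hN x
    refine ⟨s, hs, fun n hn => ?_⟩
    obtain ⟨a, rfl⟩ := Submodule.mem_span_singleton.mp hn
    rw [smul_comm, hx, smul_zero]
  | sup P Q hP hQ ihP ihQ =>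
    obtain ⟨s, hs, hsP⟩ := ihP
    obtain ⟨t, ht, htQ⟩ := ihQ
    refine ⟨s * t, fun h => (‹p.IsPrime›.mem_or_mem h).elim hs ht, fun n hn => ?_⟩
    obtain ⟨x, hx, y, hy, rfl⟩ := Submodule.mem_sup.mp hn
    rw [map_mul, smul_add, mul_smul, mul_smul, htQ y hy, smul_comm, hsP x hx, smul_zero,
      smul_zero, add_zero]

theorem IsFiberwiseAcyclic.of_torsion {p : Ideal R} [p.IsPrime]
    (hgt : ∀ J > p, ∀ (N : Type u) [AddCommGroup N] [Module A N],
      J ≤ (Module.annihilator A N).comap (algebraMap R A) → IsFiberwiseAcyclic R A N)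
    (hpN : p ≤ (Module.annihilator A N).comap (algebraMap R A))
    (hN : ∀ n : N, ∃ s ∉ p, algebraMap R A s • n = 0) : IsFiberwiseAcyclic R A N := by
  refine .of_forall_fg fun P hP => ?_
  obtain ⟨s, hs, hsP⟩ := hP.exists_smul_eq_zero hN
  refine hgt (p ⊔ Ideal.span {s}) (lt_of_le_of_ne le_sup_left fun h => hs ?_) P
    (sup_le ?_ ?_)
  · exact h ▸ Ideal.mem_sup_right (Ideal.mem_span_singleton_self s)
  · exact hpN.trans (Ideal.comap_mono (P.subtype.annihilator_le_of_injective
      P.injective_subtype))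
  · rw [Ideal.span_singleton_le_iff_mem, Ideal.mem_comap, Module.mem_annihilator]
    exact fun n => Subtype.ext (hsP n n.2)

theorem IsFiberwiseAcyclic.of_isPrime [Module.Flat R A] {p : Ideal R} [p.IsPrime]
    (hgt : ∀ J > p, ∀ (N : Type u) [AddCommGroup N] [Module A N],
      J ≤ (Module.annihilator A N).comap (algebraMap R A) → IsFiberwiseAcyclic R A N)
    (hpN : p ≤ (Module.annihilator A N).comap (algebraMap R A)) : IsFiberwiseAcyclic R A N := by
  let ι : N →ₗ[A] FiberRing R A p ⊗[A] N := TensorProduct.mk A (FiberRing R A p) N 1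
  have hker : IsFiberwiseAcyclic R A (LinearMap.ker ι) := by
    refine .of_torsion hgt (hpN.trans (Ideal.comap_mono
      ((LinearMap.ker ι).subtype.annihilator_le_of_injective (Submodule.injective_subtype _)))) ?_
    rintro ⟨n, hn⟩
    obtain ⟨s, hs, hsn⟩ := exists_smul_eq_zero_of_one_tmul_eq_zero hpN hn
    exact ⟨s, hs, Subtype.ext hsn⟩
  have hcoker : IsFiberwiseAcyclic R A ((FiberRing R A p ⊗[A] N) ⧸ LinearMap.range ι) := by
    refine .of_torsion hgt (hpN.trans (Ideal.comap_mono (le_trans ?_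
      ((LinearMap.range ι).mkQ.annihilator_le_of_surjective (Submodule.mkQ_surjective _))))) ?_
    · intro a ha
      rw [Module.mem_annihilator] at ha ⊢
      intro x
      induction x with
      | zero => simp
      | add x y hx hy => rw [smul_add, hx, hy, add_zero]
      | tmul b n => rw [← tmul_smul, ha, tmul_zero]
    · intro x
      obtain ⟨x, rfl⟩ := Submodule.mkQ_surjective _ x
      obtain ⟨s, hs, n, hn⟩ := exists_smul_eq_one_tmul x
      refine ⟨s, hs, ?_⟩
      rw [← map_smul, hn]
      exact (Submodule.Quotient.mk_eq_zero _).mpr ⟨n, rfl⟩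
  have hrange : IsFiberwiseAcyclic R A (LinearMap.range ι) :=
    left_of_exact (Submodule.injective_subtype _)
      (LinearMap.exact_subtype_mkQ _) (Submodule.mkQ_surjective _) (.of_fiberRing p) hcoker
  exact of_exact (i := (LinearMap.ker ι).subtype) (q := ι.rangeRestrict)
    (Submodule.injective_subtype _)
    (LinearMap.exact_iff.mpr (by rw [LinearMap.ker_rangeRestrict, Submodule.range_subtype]))
    ι.surjective_rangeRestrict hker hrange

theorem IsFiberwiseAcyclic.of_le_annihilator [IsNoetherianRing R] [Module.Flat R A] (I : Ideal R) :
    ∀ (N : Type u) [AddCommGroup N] [Module A N],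
      I ≤ (Module.annihilator A N).comap (algebraMap R A) → IsFiberwiseAcyclic R A N := by
  induction (I : Ideal R) using IsNoetherian.induction with
  | hgt I hgt =>
  change Ideal R at I
  intro N _ _ hN
  by_cases hI : I.IsPrime
  · exact .of_isPrime hgt hN
  rcases (Ideal.not_isPrime_iff.mp hI) with rfl | ⟨a, ha, b, hb, hab⟩
  · have : Subsingleton N := by
      refine subsingleton_of_forall_eq 0 fun n => ?_
      simpa using Module.mem_annihilator.mp (hN (Submodule.mem_top (x := (1 : R)))) n
    intro K F M _ _ _ _ _ _ _ _ _ _ _ _ _ f g _ _ _ _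
    exact Function.injective_of_subsingleton _
  · have hlt {c : R} (hc : c ∉ I) : I < I ⊔ Ideal.span {c} :=
      lt_of_le_of_ne le_sup_left fun h =>
        hc (h ▸ Ideal.mem_sup_right (Ideal.mem_span_singleton_self c))
    let P : Submodule A N := LinearMap.range (LinearMap.lsmul A N (algebraMap R A b))
    refine of_exact (i := P.subtype) (q := P.mkQ) P.injective_subtype
      (LinearMap.exact_subtype_mkQ P) P.mkQ_surjective ?_ ?_
    · refine hgt _ (hlt ha) P (sup_le (hN.trans (Ideal.comap_mono
        (P.subtype.annihilator_le_of_injective P.injective_subtype))) ?_)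
      rw [Ideal.span_singleton_le_iff_mem, Ideal.mem_comap, Module.mem_annihilator]
      rintro ⟨_, n, rfl⟩
      refine Subtype.ext ?_
      have := Module.mem_annihilator.mp (hN hab) n
      rwa [map_mul, mul_smul] at this
    · refine hgt _ (hlt hb) (N ⧸ P) (sup_le (hN.trans (Ideal.comap_mono
        (P.mkQ.annihilator_le_of_surjective P.mkQ_surjective))) ?_)
      rw [Ideal.span_singleton_le_iff_mem, Ideal.mem_comap, Module.mem_annihilator]
      intro x
      obtain ⟨n, rfl⟩ := P.mkQ_surjective x
      rw [← map_smul]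
      exact (Submodule.Quotient.mk_eq_zero _).mpr ⟨n, rfl⟩

theorem IsFiberwiseFlat.flat_of_isNoetherianRing [IsNoetherianRing R] [Module.Flat R A]
    {M : Type u} [AddCommGroup M] [Module R M] [Module A M] [IsScalarTower R A M]
    (hM : IsFiberwiseFlat R A M) : Module.Flat A M := by
  refine Module.Flat.iff_lTensor_preserves_injective_linearMap.mpr fun N' N _ _ _ _ i hi => ?_
  rw [LinearMap.lTensor_inj_iff_rTensor_inj]
  exact (IsFiberwiseAcyclic.of_le_annihilator (⊥ : Ideal R) (N ⧸ LinearMap.range i)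
    bot_le).rTensor_injective hi (LinearMap.exact_map_mkQ_range i) (Submodule.mkQ_surjective _) hM

theorem smul_top_ne_top_of_faithfullyFlat_baseChange {A M B : Type*} [CommRing A] [AddCommGroup M]
    [Module A M] [CommRing B] [Algebra A B] [Module.FaithfullyFlat B (B ⊗[A] M)] {m : Ideal A}
    (hm : m ≠ ⊤) (φ : B →ₐ[A] A ⧸ m) : m • (⊤ : Submodule A M) ≠ ⊤ := by
  intro h
  let _ : Algebra B (A ⧸ m) := φ.toRingHom.toAlgebra
  have : IsScalarTower A B (A ⧸ m) := .of_algebraMap_eq fun a => (φ.commutes a).symm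
  have : Nontrivial (A ⧸ m) := Ideal.Quotient.nontrivial_iff.mpr hm
  have hsub : Subsingleton ((A ⧸ m) ⊗[A] M) := by
    have : Subsingleton (M ⧸ m • (⊤ : Submodule A M)) :=
      Submodule.Quotient.subsingleton_iff.mpr h
    exact (TensorProduct.quotTensorEquivQuotSMul M m).toEquiv.subsingleton
  have : Subsingleton ((A ⧸ m) ⊗[B] (B ⊗[A] M)) :=
    (TensorProduct.AlgebraTensorModule.cancelBaseChange A B B (A ⧸ m) M).toEquiv.subsingleton
  exact not_subsingleton (A ⧸ m)
    ((Module.FaithfullyFlat.subsingleton_tensorProduct_iff_left B (A ⧸ m)).mp this)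

/-- The canonical map from the fiber ring of `A` over the contraction of `m` to `A ⧸ m`. -/
noncomputable def FiberRing.toQuotient (m : Ideal A) [m.IsMaximal] :
    FiberRing R A (m.comap (algebraMap R A)) →ₐ[A] A ⧸ m :=
  letI : Field (A ⧸ m) := Ideal.Quotient.field m
  Algebra.TensorProduct.lift (Algebra.ofId A (A ⧸ m))
    (IsFractionRing.liftAlgHom
      (g := Ideal.quotientMapₐ (I := m.comap (algebraMap R A)) m (Algebra.ofId R A) le_rfl)
      (Ideal.quotientMap_injective (I := m) (f := algebraMap R A)))
    fun _ _ => Commute.all _ _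

end Fiberwise

theorem fiber_criterion_for_faithful_flatness
    (R A M : Type) [CommRing R] [IsNoetherianRing R] [CommRing A] [Algebra R A]
    [AddCommGroup M] [Module R M] [Module A M] [IsScalarTower R A M]
    [Module.Flat R A] [Module.Flat R M]
    (fiber_faithfully_flat : ∀ (p : Ideal R) [p.IsPrime],
      Module.FaithfullyFlat (A ⊗[R] FractionRing (R ⧸ p))
        ((A ⊗[R] FractionRing (R ⧸ p)) ⊗[A] M)) :
    Module.FaithfullyFlat A M := by
  have hM : IsFiberwiseFlat R A M := ⟨‹_›, fun p _ => (fiber_faithfully_flat p).toFlat⟩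
  have := hM.flat_of_isNoetherianRing
  refine ⟨fun m hm => ?_⟩
  let p : Ideal R := m.comap (algebraMap R A)
  have : Module.FaithfullyFlat (FiberRing R A p) (FiberRing R A p ⊗[A] M) :=
    fiber_faithfully_flat p
  exact smul_top_ne_top_of_faithfullyFlat_baseChange hm.ne_top (FiberRing.toQuotient (R := R) m)
end

section
/- Let R be a commutative noetherian ring, f : R → A a ring homomorphism, and M an A-module. Assume that for every prime ideal p of R the following hold: (i) the canonical map pA ⊗_A M → pM is injective (equivalently, Tor_1^A(A/pA, M) = 0); (ii) the (A ⊗_R k(p))-module M ⊗_R k(p) is flat; (iii) either A is noetherian, or Tor_1^A((A/pA)_tf, M) = 0. Then M is a flat A-module. -/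
/-!
Theorem 4.1 (fiber criterion for flatness, Tor version): let `R` be noetherian, `R → A` a ring
map and `M` an `A`-module.  Assume, for every prime `p` of `R`:
(i) `Tor₁^A(A/pA, M) = 0` (equivalently, `pA ⊗_A M → pM` is injective);
(ii) the fiber `M ⊗_R k(p)` is a flat `A ⊗_R k(p)`-module (realized as the base change
`(A ⊗[R] k(p)) ⊗[A] M`, where `k(p) = Frac(R ⧸ p)`);
(iii) either `A` is noetherian, or `Tor₁^A((A/pA)_tf, M) = 0`, where `(A/pA)_tf` is the
quotient of `A/pA` by its `R/p`-torsion submodule.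
Then `M` is flat over `A`.
-/

set_option synthInstance.maxHeartbeats 1000000

open TensorProduct CategoryTheory

/-- The torsion of `N` with respect to the domain `R ⧸ p` (acting through `f : R →+* B`),
as a `B`-submodule of `N`: the elements killed by (the image of) some `r ∉ p`, i.e. by some
nonzero element of `R ⧸ p`. -/
def relTorsion (R : Type) [CommRing R] (p : Ideal R) (hp : p.IsPrime)
    (B : Type) [CommRing B] (f : R →+* B)
    (N : Type) [AddCommGroup N] [Module B N] : Submodule B N where
  carrier := {x | ∃ r : R, r ∉ p ∧ f r • x = 0}
  zero_mem' := ⟨1, fun h => hp.ne_top ((Ideal.eq_top_iff_one p).mpr h), smul_zero _⟩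
  add_mem' := by
    rintro x y ⟨r, hr, hrx⟩ ⟨s, hs, hsy⟩
    refine ⟨r * s, fun h => (hp.mem_or_mem h).elim hr hs, ?_⟩
    have h1 : (f r * f s) • x = 0 := by rw [mul_comm, mul_smul, hrx, smul_zero]
    have h2 : (f r * f s) • y = 0 := by rw [mul_smul, hsy, smul_zero]
    rw [map_mul, smul_add, h1, h2, add_zero]
  smul_mem' := by
    rintro b x ⟨r, hr, hrx⟩
    refine ⟨r, hr, ?_⟩
    rw [smul_smul, mul_comm, ← smul_smul, hrx, smul_zero]

theorem LinearMap.lTensor_ker_subtype_injective_of_exact {A K₂ K₁ F M : Type*} [CommRing A]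
    [AddCommGroup K₂] [Module A K₂] [AddCommGroup K₁] [Module A K₁]
    [AddCommGroup F] [Module A F] [AddCommGroup M] [Module A M]
    (d₂ : K₂ →ₗ[A] K₁) (d₁ : K₁ →ₗ[A] F) (π : F →ₗ[A] M)
    (h₂ : d₁ ∘ₗ d₂ = 0) (h₁ : Function.Exact d₁ π)
    (X : Type*) [AddCommGroup X] [Module A X]
    (hX : Function.Exact (d₂.lTensor X) (d₁.lTensor X)) :
    Function.Injective ((LinearMap.ker π).subtype.lTensor X) := by
  let e : K₁ →ₗ[A] LinearMap.ker π := d₁.codRestrict _ fun x => h₁.apply_apply_eq_zero x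
  have he : (LinearMap.ker π).subtype ∘ₗ e = d₁ := rfl
  have hes : Function.Surjective e := fun x => by
    obtain ⟨y, hy⟩ := (h₁ x.1).1 x.2
    exact ⟨y, Subtype.ext hy⟩
  have he₂ : e ∘ₗ d₂ = 0 := by
    ext x
    exact LinearMap.congr_fun h₂ x
  rw [injective_iff_map_eq_zero]
  intro x hx
  obtain ⟨y, rfl⟩ := LinearMap.lTensor_surjective X hes x
  rw [← LinearMap.lTensor_comp_apply, he] at hx
  obtain ⟨z, rfl⟩ := (hX y).1 hx
  rw [← LinearMap.lTensor_comp_apply, he₂, LinearMap.lTensor_zero, LinearMap.zero_apply]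

/-- A flat presentation of `M` detecting the vanishing of `Tor₁(-, M)`. -/
theorem exists_flat_presentation_of_tor_one (A M : Type) [CommRing A] [AddCommGroup M]
    [Module A M] :
    ∃ (F : Type) (_ : AddCommGroup F) (_ : Module A F) (π : F →ₗ[A] M),
      Module.Flat A F ∧ Function.Surjective π ∧
      ∀ (X : Type) [AddCommGroup X] [Module A X],
        Subsingleton (((Tor (ModuleCat A) 1).obj (ModuleCat.of A X)).obj (ModuleCat.of A M)) →
        Function.Injective ((LinearMap.ker π).subtype.lTensor X) := by
  let P := projectiveResolution (ModuleCat.of A M)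
  have : Module.Projective A (P.complex.X 0) :=
    (IsProjective.iff_projective (P.complex.X 0)).2 (P.projective 0)
  refine ⟨P.complex.X 0, inferInstance, inferInstance, (P.π.f 0).hom, inferInstance,
    (ModuleCat.epi_iff_surjective (P.π.f 0)).1 inferInstance, fun X _ _ hX => ?_⟩
  refine LinearMap.lTensor_ker_subtype_injective_of_exact (P.complex.d 2 1).hom
    (P.complex.d 1 0).hom (P.π.f 0).hom ?_ ?_ X ?_
  · rw [← ModuleCat.hom_comp, P.complex.d_comp_d, ModuleCat.hom_zero]
  · exact (ShortComplex.ShortExact.moduleCat_exact_iff_function_exact _).1 P.exact₀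
  · let G := (MonoidalCategory.tensoringLeft (ModuleCat A)).obj (ModuleCat.of A X)
    have : Subsingleton ((G.leftDerived 1).obj (ModuleCat.of A M)) := hX
    have h0 : Limits.IsZero
        (((G.mapHomologicalComplex (ComplexShape.down ℕ)).obj P.complex).homology 1) :=
      Limits.IsZero.of_iso (ModuleCat.isZero_of_subsingleton _)
        (P.isoLeftDerivedObj G 1).symm
    have h1 := ((HomologicalComplex.exactAt_iff' _ 2 1 0
      (by simp only [ChainComplex.prev]; rfl) (by simp)).1
        ((HomologicalComplex.exactAt_iff_isZero_homology _ _).2 h0))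
    exact (ShortComplex.ShortExact.moduleCat_exact_iff_function_exact _).1 h1

namespace Submodule

variable {A N : Type*} [CommRing A] [AddCommGroup N] [Module A N]

theorem smul_quotient_eq_zero {a : A} (h : ∀ x : N, a • x = 0) (S : Submodule A N)
    (x : N ⧸ S) : a • x = 0 := by
  obtain ⟨y, rfl⟩ := S.mkQ_surjective x
  rw [← map_smul, h, map_zero]

theorem smul_quotient_eq_zero_of_range_lsmul_le {a : A} {S : Submodule A N}
    (h : (LinearMap.lsmul A N a).range ≤ S) (x : N ⧸ S) : a • x = 0 := by
  obtain ⟨y, rfl⟩ := S.mkQ_surjective x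
  rw [← map_smul]
  exact (Submodule.Quotient.mk_eq_zero _).2 (h ⟨y, rfl⟩)

end Submodule

namespace LinearMap

section lTensor

variable {A K F : Type*} [CommRing A] [AddCommGroup K] [Module A K] [AddCommGroup F] [Module A F]
  (f : K →ₗ[A] F) {N N' N'' : Type*} [AddCommGroup N] [Module A N]
  [AddCommGroup N'] [Module A N'] [AddCommGroup N''] [Module A N'']

theorem rTensor_lTensor_comm_apply (g : N' →ₗ[A] N) (x : N' ⊗[A] K) :
    g.rTensor F (f.lTensor N' x) = f.lTensor N (g.rTensor K x) := by
  rw [← comp_apply, ← comp_apply, rTensor_comp_lTensor, lTensor_comp_rTensor]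

/-- With flat target, injectivity of `N ⊗ f` is stable under extensions in `N`. -/
theorem lTensor_injective_of_exact_s3 [Module.Flat A F] {i : N' →ₗ[A] N} {q : N →ₗ[A] N''}
    (hi : Function.Injective i) (hiq : Function.Exact i q) (hq : Function.Surjective q)
    (h' : Function.Injective (f.lTensor N')) (h'' : Function.Injective (f.lTensor N'')) :
    Function.Injective (f.lTensor N) := by
  rw [injective_iff_map_eq_zero]
  intro x hx
  have hqx : q.rTensor K x = 0 := h'' <| by
    rw [← rTensor_lTensor_comm_apply, hx, map_zero, map_zero]
  obtain ⟨y, rfl⟩ := (rTensor_exact K hiq hq x).1 hqx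
  rw [← rTensor_lTensor_comm_apply] at hx
  have hy := (injective_iff_map_eq_zero _).1
    (Module.Flat.rTensor_preserves_injective_linearMap (M := F) i hi) _ hx
  rw [(injective_iff_map_eq_zero _).1 h' y hy, map_zero]

theorem lTensor_injective_of_comp_eq_id {i : N' →ₗ[A] N} {q : N →ₗ[A] N'}
    (hqi : q ∘ₗ i = id) (h : Function.Injective (f.lTensor N)) :
    Function.Injective (f.lTensor N') := by
  rw [injective_iff_map_eq_zero]
  intro x hx
  have hix : i.rTensor K x = 0 := h <| by
    rw [← rTensor_lTensor_comm_apply, hx, map_zero, map_zero]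
  rw [← id_apply (R := A) x, ← rTensor_id, ← hqi, rTensor_comp_apply, hix, map_zero]

theorem lTensor_injective_of_forall_fg_s3 [Module.Flat A F]
    (h : ∀ S : Submodule A N, S.FG → Function.Injective (f.lTensor S)) :
    Function.Injective (f.lTensor N) := by
  rw [injective_iff_map_eq_zero]
  intro x hx
  obtain ⟨S, hS, hxS⟩ :=
    TensorProduct.exists_finite_submodule_left_of_setFinite {x} (Set.finite_singleton x)
  obtain ⟨y, rfl⟩ := hxS rfl
  rw [← rTensor_lTensor_comm_apply] at hx
  have hy := (injective_iff_map_eq_zero _).1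
    (Module.Flat.rTensor_preserves_injective_linearMap (M := F) S.subtype S.subtype_injective)
    _ hx
  rw [(injective_iff_map_eq_zero _).1 (h S (Module.Finite.iff_fg.1 hS)) y hy, map_zero]

theorem lTensor_finsupp_injective (I : Type*) (h : Function.Injective (f.lTensor N)) :
    Function.Injective (f.lTensor (I →₀ N)) := by
  rw [injective_iff_map_eq_zero]
  intro x hx
  classical
  apply (TensorProduct.finsuppLeft A A N K I).injective
  rw [map_zero]
  ext i
  apply h
  rw [TensorProduct.finsuppLeft_apply, ← rTensor_lTensor_comm_apply, hx]
  simp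

/-- If `0 → K → F → M → 0` is exact and tensoring `K → F` with the cokernel of an injection `g`
keeps it injective, then `g ⊗ M` is injective. -/
theorem rTensor_injective_of_lTensor_injective_s3 [Module.Flat A F] {M : Type*} [AddCommGroup M]
    [Module A M] {f : K →ₗ[A] F} {π : F →ₗ[A] M} (hfπ : Function.Exact f π)
    (hπ : Function.Surjective π) {g : N' →ₗ[A] N} {q : N →ₗ[A] N''}
    (hg : Function.Injective g) (hgq : Function.Exact g q) (hq : Function.Surjective q)
    (h : Function.Injective (f.lTensor N'')) : Function.Injective (g.rTensor M) := by
  rw [injective_iff_map_eq_zero]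
  intro u hu
  obtain ⟨u, rfl⟩ := lTensor_surjective N' hπ u
  rw [rTensor_lTensor_comm_apply] at hu
  obtain ⟨v, hv⟩ := (lTensor_exact N hfπ hπ _).1 hu
  have hqv : q.rTensor K v = 0 := h <| by
    rw [← rTensor_lTensor_comm_apply, hv, ← rTensor_comp_apply, hgq.linearMap_comp_eq_zero,
      rTensor_zero, zero_apply, map_zero]
  obtain ⟨w, rfl⟩ := (rTensor_exact K hgq hq v).1 hqv
  rw [← rTensor_lTensor_comm_apply] at hv
  rw [← Module.Flat.rTensor_preserves_injective_linearMap (M := F) g hg hv]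
  exact (lTensor_exact N' hfπ hπ _).2 ⟨w, rfl⟩

/-- Let `N ≅ G / L` be such that the endomorphism `r` of `N` is injective. If `G ⊗ f` and
`(L / rL) ⊗ f` are injective, then `r` is injective on `N ⊗ K`. -/
theorem smul_eq_zero_of_lTensor_injective [Module.Flat A F] {G : Type*} [AddCommGroup G]
    [Module A G] (r : A) (hrG : ∀ g : G, r • g = 0 → g = 0)
    (hrN : ∀ n : N, r • n = 0 → n = 0) (q : G →ₗ[A] N) (hq : Function.Surjective q)
    (hG : Function.Injective (f.lTensor G))
    (hL : Function.Injective
      (f.lTensor (ker q ⧸ LinearMap.range (LinearMap.lsmul A (ker q) r))))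
    (x : N ⊗[A] K) (hx : r • x = 0) : x = 0 := by
  let L := ker q
  let rL := LinearMap.lsmul A L r
  let rG := LinearMap.lsmul A G r
  have hLG : rL.range ≤ rG.range.comap L.subtype := by
    rintro _ ⟨l, rfl⟩
    exact ⟨l, rfl⟩
  let j : (L ⧸ rL.range) →ₗ[A] (G ⧸ rG.range) := Submodule.mapQ _ _ L.subtype hLG
  have hj : Function.Injective j := by
    rw [← ker_eq_bot, Submodule.ker_mapQ, Submodule.eq_bot_iff]
    rintro _ ⟨l, ⟨g, hg⟩, rfl⟩
    have hg' : r • g = (l : G) := hg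
    have : q g = 0 := hrN _ (by rw [← map_smul, hg']; exact l.2)
    refine (Submodule.Quotient.mk_eq_zero _).2 ⟨⟨g, this⟩, Subtype.ext hg⟩
  have hjK : Function.Injective (j.rTensor K) := by
    have : Function.Injective (f.lTensor (G ⧸ rG.range) ∘ j.rTensor K) := by
      have : f.lTensor (G ⧸ rG.range) ∘ j.rTensor K =
          j.rTensor F ∘ f.lTensor (L ⧸ rL.range) :=
        funext fun x => (rTensor_lTensor_comm_apply f j x).symm
      rw [this]
      exact (Module.Flat.rTensor_preserves_injective_linearMap (M := F) j hj).comp hL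
    exact this.of_comp
  have hLq : Function.Exact L.subtype q := q.exact_subtype_ker_map
  have hrLQ : Function.Exact rL rL.range.mkQ := exact_map_mkQ_range rL
  have hsmul : ∀ {P : Type _} [AddCommGroup P] [Module A P] (y : P ⊗[A] K),
      (LinearMap.lsmul A P r).rTensor K y = r • y := fun y => by
    induction y with
    | zero => simp
    | add a b ha hb => rw [map_add, ha, hb, smul_add]
    | tmul a b => rfl
  have hrGF : Function.Injective (rG.rTensor F) :=
    Module.Flat.rTensor_preserves_injective_linearMap (M := F) rG
      ((injective_iff_map_eq_zero _).2 hrG)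
  have hrGK : Function.Injective (rG.rTensor K) := by
    have : Function.Injective (f.lTensor G ∘ rG.rTensor K) := by
      have : f.lTensor G ∘ rG.rTensor K = rG.rTensor F ∘ f.lTensor G :=
        funext fun x => (rTensor_lTensor_comm_apply f rG x).symm
      rw [this]
      exact hrGF.comp hG
    exact this.of_comp
  obtain ⟨y, rfl⟩ := rTensor_surjective K hq x
  rw [← map_smul] at hx
  obtain ⟨z, hz⟩ := (rTensor_exact K hLq hq _).1 hx
  have hz0 : rL.range.mkQ.rTensor K z = 0 := hjK <| by
    rw [← rTensor_comp_apply, Submodule.mapQ_mkQ, rTensor_comp_apply, hz, ← hsmul,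
      ← rTensor_comp_apply, (exact_map_mkQ_range rG).linearMap_comp_eq_zero, rTensor_zero,
      zero_apply, map_zero]
  obtain ⟨w, rfl⟩ := (rTensor_exact K hrLQ (Submodule.mkQ_surjective _) z).1 hz0
  have hyw : y = L.subtype.rTensor K w := hrGK <| by
    rw [hsmul, ← hz, hsmul, hsmul, map_smul]
  rw [hyw]
  exact (rTensor_exact K hLq hq _).2 ⟨w, rfl⟩

end lTensor

end LinearMap

section Fiber

variable {R A : Type*} [CommRing R] [CommRing A] [Algebra R A] (p : Ideal R) [hp : p.IsPrime]

/-- The fiber ring `A ⊗ k(p)`. -/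
local notation "Fib" => A ⊗[R] FractionRing (R ⧸ p)

/-- The kernel of `X → (A ⊗ k(p)) ⊗ X` is `p`-torsion, for `X` killed by `p`. -/
theorem exists_smul_eq_zero_of_one_tmul_eq_zero_s3 {X : Type*} [AddCommGroup X] [Module A X]
    (hX : ∀ r ∈ p, ∀ x : X, algebraMap R A r • x = 0) (x : X)
    (hx : (1 : Fib) ⊗ₜ[A] x = 0) : ∃ r ∉ p, algebraMap R A r • x = 0 := by
  let _ : Module R X := Module.compHom X (algebraMap R A)
  have : IsScalarTower R A X := ⟨fun r a x => by
    rw [Algebra.smul_def, mul_smul]; rfl⟩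
  have htors : Module.IsTorsionBySet R X p := fun x r => hX r r.2 x
  let _ : Module (R ⧸ p) X := htors.module
  have : IsScalarTower R (R ⧸ p) X := htors.isScalarTower
  have h1 : x ⊗ₜ[R] (1 : FractionRing (R ⧸ p)) = 0 := by
    have := congrArg (AlgebraTensorModule.cancelBaseChange R A A X (FractionRing (R ⧸ p)) ∘
      TensorProduct.comm A Fib X) hx
    simpa [Algebra.TensorProduct.one_def] using this
  have h2 : (1 : FractionRing (R ⧸ p)) ⊗ₜ[R ⧸ p] x = 0 := by
    have := congrArg (TensorProduct.comm (R ⧸ p) X (FractionRing (R ⧸ p)) ∘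
      TensorProduct.mapOfCompatibleSMul (R ⧸ p) R R X (FractionRing (R ⧸ p))) h1
    simpa using this
  obtain ⟨c, hc⟩ := (IsLocalizedModule.eq_zero_iff (nonZeroDivisors (R ⧸ p))
    (TensorProduct.mk (R ⧸ p) (FractionRing (R ⧸ p)) X 1)).1 h2
  obtain ⟨r, hr⟩ := Ideal.Quotient.mk_surjective c.1
  refine ⟨r, fun hrp => nonZeroDivisors.ne_zero c.2 ?_, ?_⟩
  · rw [← hr, Ideal.Quotient.eq_zero_iff_mem.2 hrp]
  · rw [Submonoid.smul_def, ← hr] at hc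
    exact hc

theorem isUnit_algebraMap_fiber {r : R} (hr : r ∉ p) :
    IsUnit (algebraMap A Fib (algebraMap R A r)) := by
  have h : IsUnit (algebraMap R (FractionRing (R ⧸ p)) r) := by
    rw [IsScalarTower.algebraMap_apply R (R ⧸ p) (FractionRing (R ⧸ p)), isUnit_iff_ne_zero,
      Ne, FaithfulSMul.algebraMap_eq_zero_iff, Ideal.Quotient.algebraMap_eq,
      Ideal.Quotient.eq_zero_iff_mem]
    exact hr
  have := h.map (Algebra.TensorProduct.includeRight : FractionRing (R ⧸ p) →ₐ[R] Fib)
  rwa [AlgHom.commutes, IsScalarTower.algebraMap_apply R A Fib] at this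

theorem exists_smul_fiber_eq_algebraMap (c : Fib) :
    ∃ r ∉ p, ∃ a : A, algebraMap R A r • c = algebraMap A Fib a := by
  induction c with
  | zero => exact ⟨1, p.one_notMem, 0, by simp⟩
  | add x y hx hy =>
    obtain ⟨r, hr, a, hra⟩ := hx
    obtain ⟨s, hs, b, hsb⟩ := hy
    refine ⟨r * s, fun h => (hp.mem_or_mem h).elim hr hs,
      algebraMap R A s * a + algebraMap R A r * b, ?_⟩
    rw [smul_add, map_add, map_mul, mul_smul, mul_smul, hsb, smul_comm, hra, map_mul, map_mul]
    exact congrArg₂ (· + ·) (Algebra.smul_def (algebraMap R A s) (algebraMap A Fib a))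
      (Algebra.smul_def (algebraMap R A r) (algebraMap A Fib b))
  | tmul a k =>
    obtain ⟨n, d, hd, rfl⟩ := IsFractionRing.div_surjective (A := R ⧸ p) k
    obtain ⟨n, rfl⟩ := Ideal.Quotient.mk_surjective n
    obtain ⟨d, rfl⟩ := Ideal.Quotient.mk_surjective d
    refine ⟨d, fun h => nonZeroDivisors.ne_zero hd (Ideal.Quotient.eq_zero_iff_mem.2 h),
      algebraMap R A n * a, ?_⟩
    rw [algebraMap_smul, TensorProduct.smul_tmul', TensorProduct.smul_tmul, ← Algebra.smul_def,
      Algebra.TensorProduct.algebraMap_apply, Algebra.algebraMap_self_apply,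
      TensorProduct.smul_tmul]
    congr 1
    have hd0 := IsFractionRing.to_map_ne_zero_of_mem_nonZeroDivisors (K := FractionRing (R ⧸ p)) hd
    rw [Algebra.smul_def, Algebra.smul_def,
      IsScalarTower.algebraMap_apply R (R ⧸ p) (FractionRing (R ⧸ p)),
      IsScalarTower.algebraMap_apply R (R ⧸ p) (FractionRing (R ⧸ p)), mul_one]
    exact mul_div_cancel₀ _ hd0

theorem eq_zero_of_smul_fiber_tensor {X : Type*} [AddCommGroup X] [Module A X] {r : R}
    (hr : r ∉ p) {z : Fib ⊗[A] X} (hz : algebraMap R A r • z = 0) : z = 0 := by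
  obtain ⟨u, hu⟩ := isUnit_algebraMap_fiber (A := A) p hr
  rw [← algebraMap_smul Fib, ← hu] at hz
  exact (smul_eq_zero_iff_eq u).1 hz

theorem exists_smul_fiber_tensor_eq {X : Type*} [AddCommGroup X] [Module A X]
    (z : Fib ⊗[A] X) :
    ∃ r ∉ p, ∃ x : X, algebraMap R A r • z = (1 : Fib) ⊗ₜ[A] x := by
  induction z with
  | zero => exact ⟨1, p.one_notMem, 0, by simp⟩
  | add x y hx hy =>
    obtain ⟨r, hr, a, hra⟩ := hx
    obtain ⟨s, hs, b, hsb⟩ := hy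
    refine ⟨r * s, fun h => (hp.mem_or_mem h).elim hr hs,
      algebraMap R A s • a + algebraMap R A r • b, ?_⟩
    rw [smul_add, map_mul, mul_smul, mul_smul, hsb, smul_comm, hra, TensorProduct.tmul_add,
      TensorProduct.tmul_smul, TensorProduct.tmul_smul]
  | tmul c x =>
    obtain ⟨r, hr, a, hra⟩ := exists_smul_fiber_eq_algebraMap p c
    refine ⟨r, hr, a • x, ?_⟩
    rw [TensorProduct.smul_tmul', hra, Algebra.algebraMap_eq_smul_one, TensorProduct.smul_tmul]

end Fiber

theorem algebraMap_smul_quotient_eq_zero {R A : Type*} [CommRing R] [CommRing A]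
    [Algebra R A] (p : Ideal R) {r : R} (hr : r ∈ p)
    (x : A ⧸ Ideal.map (algebraMap R A) p) : algebraMap R A r • x = 0 := by
  obtain ⟨a, rfl⟩ := Ideal.Quotient.mk_surjective x
  rw [← Ideal.Quotient.mkₐ_eq_mk A, ← map_smul, Ideal.Quotient.mkₐ_eq_mk,
    Ideal.Quotient.eq_zero_iff_mem]
  exact Ideal.mul_mem_right _ _ (Ideal.mem_map_of_mem _ hr)

theorem algebraMap_smul_eq_zero_of_mem_sup_span {R A N : Type*} [CommRing R] [CommRing A]
    [Algebra R A] [AddCommGroup N] [Module A N] {I : Ideal R} {c : R}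
    (hI : ∀ r ∈ I, ∀ x : N, algebraMap R A r • x = 0)
    (hc : ∀ x : N, algebraMap R A c • x = 0) :
    ∀ r ∈ I ⊔ Ideal.span {c}, ∀ x : N, algebraMap R A r • x = 0 := by
  intro r hr x
  obtain ⟨s, hs, t, ht, rfl⟩ := Submodule.mem_sup.1 hr
  obtain ⟨d, rfl⟩ := Ideal.mem_span_singleton'.1 ht
  rw [map_add, add_smul, hI s hs, map_mul, mul_smul, hc, smul_zero, add_zero]

theorem Ideal.lt_sup_span_singleton {R : Type*} [CommRing R] {I : Ideal R} {c : R}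
    (hc : c ∉ I) : I < I ⊔ Ideal.span {c} :=
  lt_of_le_not_ge le_sup_left fun h =>
    hc (h (Submodule.mem_sup_right (Ideal.mem_span_singleton_self c)))

section TorsionFree

variable {R A : Type} [CommRing R] [CommRing A] [Algebra R A] (p : Ideal R) [hp : p.IsPrime]

/-- The fiber ring `A ⊗ k(p)`. -/
local notation "Fib" => A ⊗[R] FractionRing (R ⧸ p)

/-- The quotient `(A ⧸ pA)_tf` of `A ⧸ pA` by its torsion. -/
local notation "Atf" => (_ ⧸ relTorsion R p hp A (algebraMap R A) (A ⧸ Ideal.map (algebraMap R A) p))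

theorem eq_zero_of_smul_quotient_relTorsion {N : Type} [AddCommGroup N] [Module A N] {r : R}
    (hr : r ∉ p) (x : N ⧸ relTorsion R p hp A (algebraMap R A) N)
    (hx : algebraMap R A r • x = 0) : x = 0 := by
  obtain ⟨n, rfl⟩ := Submodule.mkQ_surjective _ x
  rw [← map_smul, Submodule.mkQ_apply, Submodule.Quotient.mk_eq_zero] at hx
  obtain ⟨s, hs, hsx⟩ := hx
  refine (Submodule.Quotient.mk_eq_zero _).2 ⟨s * r, fun h => (hp.mem_or_mem h).elim hs hr, ?_⟩
  rw [map_mul, mul_smul, hsx]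

theorem exists_smul_eq_zero_of_fg {N : Type} [AddCommGroup N] [Module A N]
    {S : Submodule A N} (hS : S.FG) (h : ∀ x ∈ S, ∃ r ∉ p, algebraMap R A r • x = 0) :
    ∃ r ∉ p, ∀ x ∈ S, algebraMap R A r • x = 0 := by
  induction S, hS using Submodule.fg_induction with
  | singleton x =>
    obtain ⟨r, hr, hrx⟩ := h x (Submodule.mem_span_singleton_self x)
    refine ⟨r, hr, fun y hy => ?_⟩
    obtain ⟨a, rfl⟩ := Submodule.mem_span_singleton.1 hy
    rw [smul_comm, hrx, smul_zero]
  | sup S T _ _ hS hT =>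
    obtain ⟨r, hr, hrS⟩ := hS fun x hx => h x (Submodule.mem_sup_left hx)
    obtain ⟨s, hs, hsT⟩ := hT fun x hx => h x (Submodule.mem_sup_right hx)
    refine ⟨r * s, fun h => (hp.mem_or_mem h).elim hr hs, fun x hx => ?_⟩
    obtain ⟨y, hy, z, hz, rfl⟩ := Submodule.mem_sup.1 hx
    rw [smul_add, map_mul, mul_smul, mul_smul, hsT z hz, smul_comm, hrS y hy, smul_zero,
      smul_zero, add_zero]

theorem exists_linearMap_quotient_relTorsion {N : Type} [AddCommGroup N] [Module A N]
    (hpN : ∀ r ∈ p, ∀ x : N, algebraMap R A r • x = 0)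
    (hN : ∀ r ∉ p, ∀ x : N, algebraMap R A r • x = 0 → x = 0) (n : N) :
    ∃ φ : Atf →ₗ[A] N, ∀ a : A,
      φ (Submodule.Quotient.mk (Ideal.Quotient.mk _ a)) = a • n := by
  let φ₀ : (A ⧸ Ideal.map (algebraMap R A) p) →ₗ[A] N :=
    Submodule.liftQ _ (LinearMap.toSpanSingleton A N n) <| by
      refine Ideal.map_le_iff_le_comap.2 fun r hr => ?_
      exact hpN r hr n
  refine ⟨Submodule.liftQ _ φ₀ ?_, fun a => rfl⟩
  rintro x ⟨r, hr, hrx⟩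
  exact hN r hr _ (by rw [← map_smul, hrx, map_zero])

theorem exists_injective_quotient_relTorsion_fiber :
    ∃ j : Atf →ₗ[A] Fib, Function.Injective j ∧ ∃ b, j b = 1 := by
  obtain ⟨j, hj⟩ := exists_linearMap_quotient_relTorsion (A := A) p (N := Fib)
    (fun r hr x => by
      have h0 : algebraMap R (FractionRing (R ⧸ p)) r = 0 := by
        rw [IsScalarTower.algebraMap_apply R (R ⧸ p) (FractionRing (R ⧸ p)),
          Ideal.Quotient.algebraMap_eq, Ideal.Quotient.eq_zero_iff_mem.2 hr, map_zero]
      induction x with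
      | zero => simp
      | add x y hx hy => rw [smul_add, hx, hy, add_zero]
      | tmul a k =>
        rw [algebraMap_smul, TensorProduct.smul_tmul', TensorProduct.smul_tmul,
          Algebra.smul_def, h0, zero_mul, TensorProduct.tmul_zero])
    (fun r hr x hx => by
      obtain ⟨u, hu⟩ := isUnit_algebraMap_fiber (A := A) p hr
      rw [← algebraMap_smul Fib, ← hu] at hx
      exact (smul_eq_zero_iff_eq u).1 hx) 1
  refine ⟨j, (injective_iff_map_eq_zero _).2 fun x hx => ?_, _, (hj 1).trans (one_smul _ _)⟩
  obtain ⟨x, rfl⟩ := Submodule.mkQ_surjective _ x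
  obtain ⟨a, rfl⟩ := Ideal.Quotient.mk_surjective x
  have ha : a • (1 : Fib) = 0 := (hj a).symm.trans hx
  refine (Submodule.Quotient.mk_eq_zero _).2 ?_
  refine exists_smul_eq_zero_of_one_tmul_eq_zero_s3 (A := A) p
    (fun r hr x => algebraMap_smul_quotient_eq_zero p hr x) _ ?_
  have : Ideal.Quotient.mk (Ideal.map (algebraMap R A) p) a = a • 1 := by
    rw [← Ideal.Quotient.mkₐ_eq_mk A, Algebra.smul_def, mul_one]
    rfl
  rw [this, ← TensorProduct.smul_tmul, ha, TensorProduct.zero_tmul]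

theorem exists_surjective_finsupp_quotient_relTorsion {N : Type} [AddCommGroup N] [Module A N]
    (hpN : ∀ r ∈ p, ∀ x : N, algebraMap R A r • x = 0)
    (hN : ∀ r ∉ p, ∀ x : N, algebraMap R A r • x = 0 → x = 0) :
    ∃ q : (N →₀ Atf) →ₗ[A] N, Function.Surjective q := by
  choose φ hφ using exists_linearMap_quotient_relTorsion p hpN hN
  refine ⟨Finsupp.lsum ℕ φ, fun n =>
    ⟨Finsupp.single n (Submodule.Quotient.mk (Ideal.Quotient.mk _ 1)), ?_⟩⟩
  rw [Finsupp.lsum_single, hφ, one_smul]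

variable {K F M : Type} [AddCommGroup K] [Module A K] [AddCommGroup F] [Module A F]
  [AddCommGroup M] [Module A M] {f : K →ₗ[A] F} {π : F →ₗ[A] M}

theorem lTensor_fiber_injective [Module.Flat A F] (h : Function.Injective (f.lTensor Atf)) :
    Function.Injective (f.lTensor Fib) := by
  obtain ⟨j, hj, b, hb⟩ := exists_injective_quotient_relTorsion_fiber (A := A) p
  rw [injective_iff_map_eq_zero]
  intro z hz
  obtain ⟨r, hr, y, hy⟩ := exists_smul_fiber_tensor_eq p z
  refine eq_zero_of_smul_fiber_tensor p hr ?_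
  have hy' : algebraMap R A r • z = j.rTensor K (b ⊗ₜ y) := by
    rw [hy, LinearMap.rTensor_tmul, hb]
  have h0 : j.rTensor F (f.lTensor _ (b ⊗ₜ y)) = 0 := by
    rw [LinearMap.rTensor_lTensor_comm_apply, ← hy', map_smul, hz, smul_zero]
  have h1 := (injective_iff_map_eq_zero _).1
    (Module.Flat.rTensor_preserves_injective_linearMap (M := F) j hj) _ h0
  rw [hy', (injective_iff_map_eq_zero _).1 h _ h1, map_zero]

/-- If `0 → C ⊗ K → C ⊗ F → C ⊗ M → 0` is exact with `C ⊗ M` flat over `C`, then `K → F` stays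
injective after tensoring with a `C`-module. -/
theorem lTensor_injective_of_flat_baseChange {C N : Type} [CommRing C] [Algebra A C]
    [AddCommGroup N] [Module A N] [Module C N] [IsScalarTower A C N]
    [Module.Flat C (C ⊗[A] M)] (hfπ : Function.Exact f π) (hπ : Function.Surjective π)
    (h : Function.Injective (f.lTensor C)) : Function.Injective (f.lTensor N) := by
  have h1 : Function.Injective ((f.baseChange C).lTensor N) :=
    LinearMap.lTensor_injective_of_exact_of_flat (π.baseChange C)
      (LinearMap.lTensor_surjective C hπ) (f.baseChange C) h (lTensor_exact C hfπ hπ) N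
  let eK := AlgebraTensorModule.cancelBaseChange A C C N K
  let eF := AlgebraTensorModule.cancelBaseChange A C C N F
  have comm : ∀ x, eF ((f.baseChange C).lTensor N x) = f.lTensor N (eK x) := fun x => by
    induction x with
    | zero => simp only [map_zero]
    | add x y hx hy => simp only [map_add, hx, hy]
    | tmul n y =>
      induction y with
      | zero => simp only [TensorProduct.tmul_zero, map_zero]
      | add x y hx hy => simp only [TensorProduct.tmul_add, map_add, hx, hy]
      | tmul c k => simp [eK, eF]
  rw [injective_iff_map_eq_zero]
  intro x hx
  obtain ⟨y, rfl⟩ := eK.surjective x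
  rw [← comm, LinearEquiv.map_eq_zero_iff] at hx
  rw [(injective_iff_map_eq_zero _).1 h1 y hx, map_zero]

theorem lTensor_injective_of_one_tmul_injective {C N : Type} [CommRing C] [Algebra A C]
    [AddCommGroup N] [Module A N] [Module.Flat C (C ⊗[A] M)] (hfπ : Function.Exact f π)
    (hπ : Function.Surjective π) (h : Function.Injective (f.lTensor C))
    (hN : ∀ x : N ⊗[A] K, (1 : C) ⊗ₜ[A] x = 0 → x = 0) : Function.Injective (f.lTensor N) := by
  rw [injective_iff_map_eq_zero]
  intro x hx
  let i : N →ₗ[A] C ⊗[A] N := TensorProduct.mk A C N 1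
  have hix : i.rTensor K x = 0 := lTensor_injective_of_flat_baseChange hfπ hπ h <| by
    rw [← LinearMap.rTensor_lTensor_comm_apply, hx, map_zero, map_zero]
  have hassoc : ∀ y, TensorProduct.assoc A C N K (i.rTensor K y) = 1 ⊗ₜ y := fun y => by
    induction y with
    | zero => simp only [TensorProduct.tmul_zero, map_zero]
    | add x y hx hy => simp only [TensorProduct.tmul_add, map_add, hx, hy]
    | tmul n k => rfl
  exact hN x (by rw [← hassoc, hix, map_zero])

theorem lTensor_injective_of_isPrime [Module.Flat A F] [Module.Flat Fib (Fib ⊗[A] M)]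
    (hfπ : Function.Exact f π) (hπ : Function.Surjective π) (hAtf : Function.Injective (f.lTensor Atf))
    (ih : ∀ r ∉ p, ∀ (N : Type) [AddCommGroup N] [Module A N],
      (∀ s ∈ p, ∀ x : N, algebraMap R A s • x = 0) → (∀ x : N, algebraMap R A r • x = 0) →
      Function.Injective (f.lTensor N))
    {N : Type} [AddCommGroup N] [Module A N]
    (hpN : ∀ r ∈ p, ∀ x : N, algebraMap R A r • x = 0) :
    Function.Injective (f.lTensor N) := by
  let T := relTorsion R p hp A (algebraMap R A) N
  have hT : Function.Injective (f.lTensor T) := by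
    refine f.lTensor_injective_of_forall_fg_s3 fun S hS => ?_
    obtain ⟨r, hr, hrS⟩ := exists_smul_eq_zero_of_fg p hS fun x _ => by
      obtain ⟨r, hr, hrx⟩ := x.2
      exact ⟨r, hr, Subtype.ext hrx⟩
    exact ih r hr S (fun s hs x => Subtype.ext (Subtype.ext (hpN s hs x.1.1)))
      fun x => Subtype.ext (hrS x.1 x.2)
  refine f.lTensor_injective_of_exact_s3 T.subtype_injective (LinearMap.exact_subtype_mkQ T)
    T.mkQ_surjective hT ?_
  have hpT : ∀ r ∈ p, ∀ x : N ⧸ T, algebraMap R A r • x = 0 := fun r hr =>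
    Submodule.smul_quotient_eq_zero (hpN r hr) T
  have htf : ∀ r ∉ p, ∀ x : N ⧸ T, algebraMap R A r • x = 0 → x = 0 := fun r hr x hx =>
    eq_zero_of_smul_quotient_relTorsion p hr x hx
  refine lTensor_injective_of_one_tmul_injective hfπ hπ (lTensor_fiber_injective p hAtf)
    fun x hx => ?_
  obtain ⟨r, hr, hx⟩ := exists_smul_eq_zero_of_one_tmul_eq_zero_s3 (A := A) p
    (fun r hr y => by
      induction y with
      | zero => rw [smul_zero]
      | add x y hx hy => rw [smul_add, hx, hy, add_zero]
      | tmul n k => rw [TensorProduct.smul_tmul', hpT r hr, TensorProduct.zero_tmul]) x hx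
  obtain ⟨q, hq⟩ := exists_surjective_finsupp_quotient_relTorsion p hpT htf
  have hG : ∀ g : (N ⧸ T) →₀ Atf, algebraMap R A r • g = 0 → g = 0 := fun g hg =>
    Finsupp.ext fun n =>
      eq_zero_of_smul_quotient_relTorsion p hr (g n) (DFunLike.congr_fun hg n)
  have hL : ∀ s ∈ p, ∀ l : LinearMap.ker q, algebraMap R A s • l = 0 := fun s hs l =>
    Subtype.ext <| Finsupp.ext fun n => Submodule.smul_quotient_eq_zero
      (algebraMap_smul_quotient_eq_zero p hs) _ (l.1 n)
  exact f.smul_eq_zero_of_lTensor_injective (algebraMap R A r) hG (htf r hr) q hq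
    (f.lTensor_finsupp_injective _ hAtf)
    (ih r hr _ (fun s hs => Submodule.smul_quotient_eq_zero (hL s hs) _)
      (Submodule.smul_quotient_eq_zero_of_range_lsmul_le le_rfl)) x hx

/-- If `A` is noetherian, the torsion of `A ⧸ pA` is killed by some `r ∉ p`. Then `A ⧸ pA` embeds into `(A ⧸ pA)_tf × A ⧸ (pA + rA)`, and the vanishing of `Tor₁`
for `(A ⧸ pA)_tf` follows from that for `A ⧸ pA` and for torsion modules. -/
theorem lTensor_quotient_relTorsion_injective [IsNoetherianRing A] [Module.Flat A F]
    (hA : Function.Injective (f.lTensor (A ⧸ Ideal.map (algebraMap R A) p)))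
    (ih : ∀ r ∉ p, ∀ (N : Type) [AddCommGroup N] [Module A N],
      (∀ s ∈ p, ∀ x : N, algebraMap R A s • x = 0) → (∀ x : N, algebraMap R A r • x = 0) →
      Function.Injective (f.lTensor N)) :
    Function.Injective (f.lTensor Atf) := by
  let B := A ⧸ Ideal.map (algebraMap R A) p
  let T : Submodule A B := relTorsion R p hp A (algebraMap R A) B
  obtain ⟨r, hr, hrT⟩ := exists_smul_eq_zero_of_fg p (IsNoetherian.noetherian T) fun x hx => hx
  let U : Submodule A B := (LinearMap.lsmul A B (algebraMap R A r)).range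
  have hTU : ∀ x ∈ T, x ∈ U → x = 0 := by
    rintro _ hx ⟨y, rfl⟩
    obtain ⟨s, hs, hsy⟩ := hx
    refine hrT y ⟨s * r, fun h => (hp.mem_or_mem h).elim hs hr, ?_⟩
    rw [map_mul, mul_smul]
    exact hsy
  let i : B →ₗ[A] (B ⧸ T) × (B ⧸ U) := T.mkQ.prod U.mkQ
  let q : (B ⧸ T) × (B ⧸ U) →ₗ[A] B ⧸ (T ⊔ U) :=
    Submodule.factor le_sup_left ∘ₗ LinearMap.fst A (B ⧸ T) (B ⧸ U) -
      Submodule.factor le_sup_right ∘ₗ LinearMap.snd A (B ⧸ T) (B ⧸ U)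
  have hi : Function.Injective i := (injective_iff_map_eq_zero _).2 fun x hx =>
    hTU x ((Submodule.Quotient.mk_eq_zero _).1 (congrArg Prod.fst hx))
      ((Submodule.Quotient.mk_eq_zero _).1 (congrArg Prod.snd hx))
  have hq : Function.Surjective q := fun x => by
    obtain ⟨b, rfl⟩ := Submodule.mkQ_surjective _ x
    refine ⟨(T.mkQ b, 0), ?_⟩
    change (T ⊔ U).mkQ b - Submodule.factor le_sup_right (0 : B ⧸ U) = _
    rw [map_zero, sub_zero]
  have hiq : Function.Exact i q := by
    rintro ⟨x, y⟩
    obtain ⟨b, rfl⟩ := Submodule.mkQ_surjective _ x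
    obtain ⟨c, rfl⟩ := Submodule.mkQ_surjective _ y
    have hqbc : q (T.mkQ b, U.mkQ c) = (T ⊔ U).mkQ (b - c) := by
      rw [map_sub]
      rfl
    rw [hqbc]
    constructor
    · intro h
      obtain ⟨t, ht, u, hu, htu⟩ := Submodule.mem_sup.1 ((Submodule.Quotient.mk_eq_zero _).1 h)
      refine ⟨b - t, Prod.ext ((Submodule.Quotient.eq _).2 ?_)
        ((Submodule.Quotient.eq _).2 ?_)⟩
      · rw [sub_sub_cancel_left]
        exact T.neg_mem ht
      · have : b - t - c = u := by rw [sub_right_comm, ← htu, add_sub_cancel_left]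
        rw [this]
        exact hu
    · rintro ⟨a, ha⟩
      have h1 := (Submodule.Quotient.eq T).1 (congrArg Prod.fst ha)
      have h2 := (Submodule.Quotient.eq U).1 (congrArg Prod.snd ha)
      refine (Submodule.Quotient.mk_eq_zero _).2 ?_
      have : b - c = -(a - b) + (a - c) := by abel
      rw [this]
      exact Submodule.add_mem_sup (T.neg_mem h1) h2
  have hE : Function.Injective (f.lTensor (B ⧸ (T ⊔ U))) := ih r hr _
    (fun s hs => Submodule.smul_quotient_eq_zero (algebraMap_smul_quotient_eq_zero p hs) _)
    (Submodule.smul_quotient_eq_zero_of_range_lsmul_le le_sup_right)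
  exact f.lTensor_injective_of_comp_eq_id (i := LinearMap.inl A (B ⧸ T) (B ⧸ U))
    (q := LinearMap.fst A (B ⧸ T) (B ⧸ U)) (LinearMap.fst_comp_inl A (B ⧸ T) (B ⧸ U))
    (f.lTensor_injective_of_exact_s3 hi hiq hq hA hE)

end TorsionFree

/-- Noetherian induction: a property of `A`-modules that is stable under extensions and passes,
for each prime `p` of `R`, from modules killed by some `J > p` to modules killed by `p`, holds
for all modules. -/
theorem noetherian_induction_of_extension {R A : Type} [CommRing R] [IsNoetherianRing R]
    [CommRing A] [Algebra R A]
    (P : ∀ (N : Type) [AddCommGroup N] [Module A N], Prop)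
    (zero : ∀ (N : Type) [AddCommGroup N] [Module A N], Subsingleton N → P N)
    (ext : ∀ (N : Type) [AddCommGroup N] [Module A N] (S : Submodule A N),
      P S → P (N ⧸ S) → P N)
    (prime : ∀ (p : Ideal R) [p.IsPrime],
      (∀ J > p, ∀ (N : Type) [AddCommGroup N] [Module A N],
        (∀ r ∈ J, ∀ x : N, algebraMap R A r • x = 0) → P N) →
      ∀ (N : Type) [AddCommGroup N] [Module A N],
        (∀ r ∈ p, ∀ x : N, algebraMap R A r • x = 0) → P N)
    (N : Type) [AddCommGroup N] [Module A N] : P N := by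
  suffices h : ∀ (I : Ideal R) (N : Type) [AddCommGroup N] [Module A N],
      (∀ r ∈ I, ∀ x : N, algebraMap R A r • x = 0) → P N from
    h ⊥ N fun r hr x => by rw [(Submodule.mem_bot R).1 hr, map_zero, zero_smul]
  intro I
  induction I using IsNoetherian.induction with
  | hgt I ih =>
    intro N _ _ hN
    by_cases htop : I = ⊤
    · refine zero N (subsingleton_of_forall_eq 0 fun x => ?_)
      simpa using hN 1 (htop ▸ Submodule.mem_top) x
    by_cases hI : Ideal.IsPrime I
    · exact prime I ih N hN
    obtain h | ⟨a, ha, b, hb, hab⟩ := Ideal.not_isPrime_iff.1 hI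
    · exact absurd h htop
    refine ext N (LinearMap.lsmul A N (algebraMap R A b)).range
      (ih _ (Ideal.lt_sup_span_singleton ha) _ (algebraMap_smul_eq_zero_of_mem_sup_span
        (fun r hr x => Subtype.ext (hN r hr x)) ?_))
      (ih _ (Ideal.lt_sup_span_singleton hb) _ (algebraMap_smul_eq_zero_of_mem_sup_span
        (fun r hr => Submodule.smul_quotient_eq_zero (hN r hr) _)
        (Submodule.smul_quotient_eq_zero_of_range_lsmul_le le_rfl)))
    rintro ⟨_, y, rfl⟩
    refine Subtype.ext ?_
    change algebraMap R A a • algebraMap R A b • y = 0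
    rw [← mul_smul, ← map_mul, hN _ hab]

theorem fiber_criterion_for_flatness_with_Tor
    (R A M : Type) [CommRing R] [IsNoetherianRing R] [CommRing A] [Algebra R A]
    [AddCommGroup M] [Module A M]
    (hyp : ∀ (p : Ideal R) [hp : p.IsPrime],
      Subsingleton (((Tor (ModuleCat A) 1).obj
          (ModuleCat.of A (A ⧸ Ideal.map (algebraMap R A) p))).obj (ModuleCat.of A M)) ∧
      Module.Flat (A ⊗[R] FractionRing (R ⧸ p)) ((A ⊗[R] FractionRing (R ⧸ p)) ⊗[A] M) ∧
      (IsNoetherianRing A ∨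
        Subsingleton (((Tor (ModuleCat A) 1).obj
          (ModuleCat.of A ((A ⧸ Ideal.map (algebraMap R A) p) ⧸
            relTorsion R p hp A (algebraMap R A)
              (A ⧸ Ideal.map (algebraMap R A) p)))).obj (ModuleCat.of A M)))) :
    Module.Flat A M := by
  obtain ⟨F, _, _, π, _, hπ, hTor⟩ := exists_flat_presentation_of_tor_one A M
  let f := (LinearMap.ker π).subtype
  have hfπ : Function.Exact f π := π.exact_subtype_ker_map
  have key : ∀ (N : Type) [AddCommGroup N] [Module A N], Function.Injective (f.lTensor N) := by
    refine noetherian_induction_of_extension (R := R) (A := A)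
      (fun N _ _ => Function.Injective (f.lTensor N)) (fun N _ _ _ => ?_)
      (fun N _ _ S => f.lTensor_injective_of_exact_s3 S.subtype_injective
        (LinearMap.exact_subtype_mkQ S) S.mkQ_surjective) fun p hp ih N _ _ hN => ?_
    · exact Function.injective_of_subsingleton _
    obtain ⟨hA, hflat, htf⟩ := hyp p
    have ih' : ∀ r ∉ p, ∀ (N : Type) [AddCommGroup N] [Module A N],
        (∀ s ∈ p, ∀ x : N, algebraMap R A s • x = 0) →
        (∀ x : N, algebraMap R A r • x = 0) → Function.Injective (f.lTensor N) :=
      fun r hr N _ _ hpN hrN => ih (p ⊔ Ideal.span {r}) (Ideal.lt_sup_span_singleton hr) N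
        (algebraMap_smul_eq_zero_of_mem_sup_span hpN hrN)
    refine lTensor_injective_of_isPrime p hfπ hπ ?_ ih' hN
    obtain _ | h := htf
    · exact lTensor_quotient_relTorsion_injective p (hTor _ hA) ih'
    · exact hTor _ h
  refine Module.Flat.iff_rTensor_preserves_injective_linearMap.2 fun N N' _ _ _ _ g hg => ?_
  exact LinearMap.rTensor_injective_of_lTensor_injective_s3 hfπ hπ hg
    (LinearMap.exact_map_mkQ_range g) (Submodule.mkQ_surjective _) (key _)
end

section
/- Let A be a commutative ring, a an ideal of A, and M an A-module. Assume that M/aM is a flat (A/a)-module and that Tor_1^A(A/a, M) = 0 (equivalently, the canonical map a ⊗_A M → M is injective). Then for every n ≥ 2, M/a^n M is a flat (A/a^n)-module, and Tor_1^A(M, N) = 0 for every A-module N annihilated by a^n. -/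
/-!
Lemma 2.4 (general form of the local criterion for flatness): let `A` be a commutative ring,
`a ⊆ A` an ideal and `M` an `A`-module.  If `M/aM` is flat over `A/a` and
`Tor₁^A(A/a, M) = 0`, then for every `n ≥ 2` the module `M/aⁿM` is flat over `A/aⁿ` and
`Tor₁^A(M, N) = 0` for every `A`-module `N` annihilated by `aⁿ`.
-/

set_option synthInstance.maxHeartbeats 1000000

open CategoryTheory

universe u

open scoped TensorProduct

namespace LinearMap

variable {A : Type*} [CommRing A]

section Diagram

variable {N' N N'' K P M : Type*}
  [AddCommGroup N'] [AddCommGroup N] [AddCommGroup N'']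
  [AddCommGroup K] [AddCommGroup P] [AddCommGroup M]
  [Module A N'] [Module A N] [Module A N''] [Module A K] [Module A P] [Module A M]
  {f : N' →ₗ[A] N} {g : N →ₗ[A] N''} {i : K →ₗ[A] P} {p : P →ₗ[A] M}

theorem rTensor_lTensor_apply (f : N' →ₗ[A] N) (i : K →ₗ[A] P) (x : N' ⊗[A] K) :
    f.rTensor P (i.lTensor N' x) = i.lTensor N (f.rTensor K x) := by
  rw [← comp_apply, ← comp_apply, rTensor_comp_lTensor, lTensor_comp_rTensor]

/-- If `f ⊗ M` and `N ⊗ i` are injective, then so is `N'' ⊗ i`. -/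
theorem lTensor_injective_of_rTensor_injective_s6 (hfg : Function.Exact f g)
    (hg : Function.Surjective g) (hip : Function.Exact i p) (hp : Function.Surjective p)
    (hN : Function.Injective (i.lTensor N)) (hM : Function.Injective (f.rTensor M)) :
    Function.Injective (i.lTensor N'') := by
  rw [injective_iff_map_eq_zero]
  intro x hx
  obtain ⟨y, rfl⟩ := rTensor_surjective K hg x
  rw [← rTensor_lTensor_apply] at hx
  obtain ⟨z, hz⟩ := (rTensor_exact P hfg hg _).1 hx
  have hz0 : p.lTensor N' z = 0 := by
    apply hM
    rw [rTensor_lTensor_apply, hz, map_zero, (lTensor_exact N hip hp).apply_apply_eq_zero]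
  obtain ⟨w, rfl⟩ := (lTensor_exact N' hip hp _).1 hz0
  rw [rTensor_lTensor_apply] at hz
  rw [← hN hz, (rTensor_exact K hfg hg).apply_apply_eq_zero]

/-- If `f ⊗ P` and `N'' ⊗ i` are injective, then `f ⊗ M` is injective. -/
theorem rTensor_injective_of_lTensor_injective_s6 (hfg : Function.Exact f g)
    (hg : Function.Surjective g) (hip : Function.Exact i p) (hp : Function.Surjective p)
    (hP : Function.Injective (f.rTensor P)) (hN'' : Function.Injective (i.lTensor N'')) :
    Function.Injective (f.rTensor M) := by
  rw [injective_iff_map_eq_zero]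
  intro x hx
  obtain ⟨y, rfl⟩ := lTensor_surjective N' hp x
  rw [rTensor_lTensor_apply] at hx
  obtain ⟨z, hz⟩ := (lTensor_exact N hip hp _).1 hx
  have hz0 : g.rTensor K z = 0 := by
    apply hN''
    rw [← rTensor_lTensor_apply, hz, map_zero, (rTensor_exact P hfg hg).apply_apply_eq_zero]
  obtain ⟨w, rfl⟩ := (rTensor_exact K hfg hg _).1 hz0
  rw [← rTensor_lTensor_apply] at hz
  rw [← hP hz, (lTensor_exact N' hip hp).apply_apply_eq_zero]

/-- Injectivity of `- ⊗ i` is stable under extensions if `f ⊗ P` is injective. -/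
theorem lTensor_injective_of_exact_s6 (hfg : Function.Exact f g) (hg : Function.Surjective g)
    (hP : Function.Injective (f.rTensor P)) (hN' : Function.Injective (i.lTensor N'))
    (hN'' : Function.Injective (i.lTensor N'')) : Function.Injective (i.lTensor N) := by
  rw [injective_iff_map_eq_zero]
  intro x hx
  have hx0 : g.rTensor K x = 0 := by
    apply hN''
    rw [← rTensor_lTensor_apply, hx, map_zero, map_zero]
  obtain ⟨y, rfl⟩ := (rTensor_exact K hfg hg _).1 hx0
  rw [← rTensor_lTensor_apply] at hx
  have hy : y = 0 := by
    apply hN'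
    apply hP
    rw [hx, map_zero, map_zero]
  rw [hy, map_zero]

theorem lTensor_exact_iff_lTensor_subtype_range_injective (Q : Type*) [AddCommGroup Q]
    [Module A Q] (hfg : Function.Exact f g) :
    Function.Exact (f.lTensor Q) (g.lTensor Q) ↔
      Function.Injective ((range g).subtype.lTensor Q) := by
  have hex : Function.Exact f g.rangeRestrict := fun x ↦ by
    rw [← hfg x, Subtype.ext_iff]
    rfl
  have hQ := lTensor_exact Q hex g.surjective_rangeRestrict
  have hcomp (x : Q ⊗[A] N) :
      g.lTensor Q x = (range g).subtype.lTensor Q (g.rangeRestrict.lTensor Q x) := by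
    rw [← lTensor_comp_apply]
    rfl
  constructor
  · intro h
    rw [injective_iff_map_eq_zero]
    intro x hx
    obtain ⟨y, rfl⟩ := lTensor_surjective Q g.surjective_rangeRestrict x
    rw [← hcomp] at hx
    exact (hQ y).2 ((h y).1 hx)
  · intro h x
    rw [← hQ x, hcomp, map_eq_zero_iff _ h]

end Diagram

end LinearMap

namespace Module.Flat

open TensorProduct

variable {A : Type u} [CommRing A] (b : Ideal A) (M : Type u) [AddCommGroup M] [Module A M]

/-- `M/bM` is flat over `A/b` if and only if `- ⊗ M` preserves injections between
`A`-modules annihilated by `b`. -/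
theorem quotient_iff_rTensor_injective :
    Module.Flat (A ⧸ b) (M ⧸ (b • ⊤ : Submodule A M)) ↔
      ∀ ⦃N' N : Type u⦄ [AddCommGroup N'] [AddCommGroup N] [Module A N'] [Module A N]
        (f : N' →ₗ[A] N), Module.IsTorsionBySet A N b → Function.Injective f →
        Function.Injective (f.rTensor M) := by
  have hs : Function.Surjective (algebraMap A (A ⧸ b)) := Ideal.Quotient.mk_surjective
  have hiff (N' N : Type u) [AddCommGroup N'] [AddCommGroup N] [Module A N'] [Module A N]
      [Module (A ⧸ b) N'] [Module (A ⧸ b) N] [IsScalarTower A (A ⧸ b) N']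
      [IsScalarTower A (A ⧸ b) N] (f : N' →ₗ[A ⧸ b] N) :
      Function.Injective (f.rTensor ((A ⧸ b) ⊗[A] M)) ↔
        Function.Injective ((f.restrictScalars A).rTensor M) := by
    have hcomm : (f.restrictScalars A).rTensor M ∘ₗ
        ((AlgebraTensorModule.cancelBaseChange A (A ⧸ b) (A ⧸ b) N' M).restrictScalars
          A).toLinearMap =
        ((AlgebraTensorModule.cancelBaseChange A (A ⧸ b) (A ⧸ b) N M).restrictScalars
          A).toLinearMap ∘ₗ (f.rTensor ((A ⧸ b) ⊗[A] M)).restrictScalars A := by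
      ext x
      induction x using TensorProduct.induction_on with
      | zero => simp
      | add x y hx hy => simp only [map_add, hx, hy]
      | tmul n t =>
        induction t using TensorProduct.induction_on with
        | zero => simp
        | add x y hx hy => simp only [TensorProduct.tmul_add, map_add, hx, hy]
        | tmul r m => simp
    have h := congrArg (fun φ ↦ Function.Injective φ) (congrArg DFunLike.coe hcomm)
    simpa using h.symm
  rw [Module.Flat.equiv_iff
    ((quotTensorEquivQuotSMul M b).symm.extendScalarsOfSurjective hs),
    Module.Flat.iff_rTensor_preserves_injective_linearMap]
  constructor
  · intro h N' N _ _ _ _ f hN hf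
    have hN' : Module.IsTorsionBySet A N' b := fun x r ↦ hf <| by
      rw [map_smul, hN, map_zero]
    let _ := hN.module
    let _ := hN'.module
    exact (hiff N' N (f.extendScalarsOfSurjective hs)).1 (h _ hf)
  · intro h N' N _ _ _ _ f hf
    let _ := Module.compHom N' (algebraMap A (A ⧸ b))
    let _ := Module.compHom N (algebraMap A (A ⧸ b))
    have : IsScalarTower A (A ⧸ b) N' := .of_algebraMap_smul fun _ _ ↦ rfl
    have : IsScalarTower A (A ⧸ b) N := .of_algebraMap_smul fun _ _ ↦ rfl
    refine (hiff N' N f).2 (h _ (fun x r ↦ ?_) hf)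
    rw [← algebraMap_smul (A ⧸ b), Ideal.Quotient.algebraMap_eq,
      Ideal.Quotient.eq_zero_iff_mem.2 r.2, zero_smul]

end Module.Flat

section LocalCriterion

variable {A : Type u} [CommRing A] {a : Ideal A} {K P M : Type u}
  [AddCommGroup K] [AddCommGroup P] [AddCommGroup M] [Module A K] [Module A P] [Module A M]
  {i : K →ₗ[A] P} {p : P →ₗ[A] M}

theorem lTensor_injective_of_surjective (hip : Function.Exact i p) (hp : Function.Surjective p)
    (hM : Module.Flat (A ⧸ a) (M ⧸ (a • ⊤ : Submodule A M)))
    {G N : Type u} [AddCommGroup G] [AddCommGroup N] [Module A G] [Module A N]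
    (g : G →ₗ[A] N) (hg : Function.Surjective g) (htors : Module.IsTorsionBySet A G a)
    (hG : Function.Injective (i.lTensor G)) : Function.Injective (i.lTensor N) :=
  LinearMap.lTensor_injective_of_rTensor_injective_s6 g.exact_subtype_ker_map hg hip hp hG
    ((Module.Flat.quotient_iff_rTensor_injective a M).1 hM _ htors
      (Submodule.subtype_injective _))

/-- If `M/aM` is flat over `A/a` and `Tor₁(A/a, M) = 0`, then `Tor₁(N, M) = 0` for every `N`
annihilated by `a`, expressed through a presentation `K → P → M → 0`. -/
theorem lTensor_injective_of_isTorsionBySet (hip : Function.Exact i p)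
    (hp : Function.Surjective p)
    (hM : Module.Flat (A ⧸ a) (M ⧸ (a • ⊤ : Submodule A M)))
    (ha : Function.Injective (i.lTensor (A ⧸ a)))
    (N : Type u) [AddCommGroup N] [Module A N] (hN : Module.IsTorsionBySet A N a) :
    Function.Injective (i.lTensor N) := by
  have hN0 : (a • ⊤ : Submodule A N) = ⊥ := le_bot_iff.1 <|
    Submodule.smul_le.2 fun r hr x _ ↦ @hN x ⟨r, hr⟩
  let e : (N ⧸ (a • ⊤ : Submodule A N)) ≃ₗ[A] N := Submodule.quotEquivOfEqBot _ hN0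
  let π : (N →₀ A) →ₗ[A] N := Finsupp.linearCombination A id
  have hπ : Function.Surjective π := Finsupp.linearCombination_id_surjective A N
  let g : (N →₀ A) ⊗[A] (A ⧸ a) →ₗ[A] N :=
    (e.toLinearMap ∘ₗ (TensorProduct.tensorQuotEquivQuotSMul N a).toLinearMap) ∘ₗ
      π.rTensor (A ⧸ a)
  have hg : Function.Surjective g :=
    (e.surjective.comp (TensorProduct.tensorQuotEquivQuotSMul N a).surjective).comp
      (LinearMap.rTensor_surjective _ hπ)
  have htors : Module.IsTorsionBySet A ((N →₀ A) ⊗[A] (A ⧸ a)) a := fun x r ↦ by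
    induction x using TensorProduct.induction_on with
    | zero => rw [smul_zero]
    | add x y hx hy => rw [smul_add, hx, hy, add_zero]
    | tmul x y =>
      rw [← TensorProduct.tmul_smul, ← algebraMap_smul (A ⧸ a), Ideal.Quotient.algebraMap_eq,
        Ideal.Quotient.eq_zero_iff_mem.2 r.2, zero_smul, TensorProduct.tmul_zero]
  have hG : Function.Injective (i.lTensor ((N →₀ A) ⊗[A] (A ⧸ a))) := by
    rw [LinearMap.lTensor_tensor]
    simpa using Module.Flat.lTensor_preserves_injective_linearMap (M := N →₀ A) _ ha
  exact lTensor_injective_of_surjective (G := (N →₀ A) ⊗[A] (A ⧸ a)) hip hp hM g hg htors hG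

theorem lTensor_injective_of_isTorsionBySet_pow [Module.Flat A P] (hip : Function.Exact i p)
    (hp : Function.Surjective p)
    (hM : Module.Flat (A ⧸ a) (M ⧸ (a • ⊤ : Submodule A M)))
    (ha : Function.Injective (i.lTensor (A ⧸ a))) (n : ℕ)
    (N : Type u) [AddCommGroup N] [Module A N]
    (hN : Module.IsTorsionBySet A N (a ^ n : Ideal A)) :
    Function.Injective (i.lTensor N) := by
  induction n generalizing N with
  | zero =>
    have : Subsingleton N := ⟨fun x y ↦ by
      rw [← one_smul A x, ← one_smul A y]
      exact (@hN x ⟨1, by simp⟩).trans (@hN y ⟨1, by simp⟩).symm⟩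
    exact Function.injective_of_subsingleton _
  | succ n ih =>
    let N' : Submodule A N := a • ⊤
    refine LinearMap.lTensor_injective_of_exact_s6 (LinearMap.exact_subtype_mkQ N')
      N'.mkQ_surjective
      (Module.Flat.rTensor_preserves_injective_linearMap _ N'.subtype_injective)
      (ih N' ?_) (lTensor_injective_of_isTorsionBySet hip hp hM ha (N ⧸ N') ?_)
    · rintro ⟨x, hx⟩ ⟨r, hr⟩
      refine Subtype.ext ?_
      change r • x = 0
      refine Submodule.smul_induction_on hx (fun s hs y _ ↦ ?_) fun x y hx hy ↦ ?_
      · rw [smul_smul]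
        exact @hN y ⟨r * s, by rw [pow_succ]; exact Ideal.mul_mem_mul hr hs⟩
      · rw [smul_add, hx, hy, add_zero]
    · rintro x ⟨r, hr⟩
      obtain ⟨x, rfl⟩ := N'.mkQ_surjective x
      change r • N'.mkQ x = 0
      rw [← map_smul, Submodule.mkQ_apply, Submodule.Quotient.mk_eq_zero]
      exact Submodule.smul_mem_smul hr trivial

end LocalCriterion

/-- Every module `Y` has a flat presentation computing the vanishing of `Tor₁(-, Y)`. -/
theorem ModuleCat.exists_presentation_subsingleton_tor_one_iff {A : Type u} [CommRing A]
    (Y : Type u) [AddCommGroup Y] [Module A Y] :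
    ∃ (P : ModuleCat.{u} A) (p : P →ₗ[A] Y), Module.Flat A P ∧ Function.Surjective p ∧
      ∀ (X : Type u) [AddCommGroup X] [Module A X],
        Subsingleton (((Tor (ModuleCat.{u} A) 1).obj (ModuleCat.of A X)).obj
          (ModuleCat.of A Y)) ↔
        Function.Injective ((LinearMap.ker p).subtype.lTensor X) := by
  let R := ProjectiveResolution.of (ModuleCat.of A Y)
  have h1 : Function.Exact (R.complex.d 2 1).hom (R.complex.d 1 0).hom :=
    (ShortComplex.ShortExact.moduleCat_exact_iff_function_exact _).1 (R.exact_succ 0)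
  have h0 : Function.Exact (R.complex.d 1 0).hom (R.π.f 0).hom :=
    (ShortComplex.ShortExact.moduleCat_exact_iff_function_exact _).1 R.exact₀
  refine ⟨R.complex.X 0, (R.π.f 0).hom, ?_, ?_, fun X _ _ ↦ ?_⟩
  · have := R.projective 0
    have := (IsProjective.iff_projective (R := A) (R.complex.X 0)).2 this
    infer_instance
  · exact (ModuleCat.epi_iff_surjective (R.π.f 0)).1 inferInstance
  · have hk : LinearMap.ker (R.π.f 0).hom = LinearMap.range (R.complex.d 1 0).hom :=
      LinearMap.exact_iff.1 h0
    let F := (MonoidalCategory.tensoringLeft (ModuleCat.{u} A)).obj (ModuleCat.of A X)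
    have e : ((Tor (ModuleCat.{u} A) 1).obj (ModuleCat.of A X)).obj (ModuleCat.of A Y) ≅
      ((F.mapHomologicalComplex _).obj R.complex).homology 1 := R.isoLeftDerivedObj F 1
    rw [← ModuleCat.isZero_iff_subsingleton, e.isZero_iff,
      ← HomologicalComplex.exactAt_iff_isZero_homology,
      HomologicalComplex.exactAt_iff' _ 2 1 0 (by simp) (by simp),
      ShortComplex.ShortExact.moduleCat_exact_iff_function_exact]
    refine (LinearMap.lTensor_exact_iff_lTensor_subtype_range_injective X h1).trans ?_
    rw [← hk]
    rfl

theorem local_criterion_general_form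
    (A : Type) [CommRing A] (a : Ideal A) (M : Type) [AddCommGroup M] [Module A M]
    (hflat : Module.Flat (A ⧸ a) (M ⧸ (a • ⊤ : Submodule A M)))
    (htor : Subsingleton (((Tor (ModuleCat A) 1).obj
        (ModuleCat.of A (A ⧸ a))).obj (ModuleCat.of A M))) :
    ∀ n : ℕ, 2 ≤ n →
      Module.Flat (A ⧸ a ^ n) (M ⧸ ((a ^ n : Ideal A) • ⊤ : Submodule A M)) ∧
      ∀ (N : Type) [AddCommGroup N] [Module A N],
        (∀ r ∈ a ^ n, ∀ x : N, r • x = 0) →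
        Subsingleton (((Tor (ModuleCat A) 1).obj
          (ModuleCat.of A M)).obj (ModuleCat.of A N)) := by
  intro n _
  obtain ⟨P, p, _, hp, hPtor⟩ :=
    ModuleCat.exists_presentation_subsingleton_tor_one_iff (A := A) M
  have hip : Function.Exact (LinearMap.ker p).subtype p := p.exact_subtype_ker_map
  have ha := (hPtor (A ⧸ a)).1 htor
  have hV (N : Type) [AddCommGroup N] [Module A N]
      (hN : Module.IsTorsionBySet A N (a ^ n : Ideal A)) :
      Function.Injective ((LinearMap.ker p).subtype.lTensor N) :=
    lTensor_injective_of_isTorsionBySet_pow hip hp hflat ha n N hN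
  refine ⟨(Module.Flat.quotient_iff_rTensor_injective _ _).2 fun N' N _ _ _ _ f hN hf ↦ ?_,
    fun N _ _ hN ↦ ?_⟩
  · refine LinearMap.rTensor_injective_of_lTensor_injective_s6 (LinearMap.exact_map_mkQ_range f)
      (Submodule.mkQ_surjective _) hip hp
      (Module.Flat.rTensor_preserves_injective_linearMap _ hf) (hV _ fun x r ↦ ?_)
    obtain ⟨x, rfl⟩ := Submodule.mkQ_surjective _ x
    rw [← map_smul, hN, map_zero]
  · obtain ⟨F, q, _, hq, hFtor⟩ :=
      ModuleCat.exists_presentation_subsingleton_tor_one_iff (A := A) N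
    rw [hFtor, LinearMap.lTensor_inj_iff_rTensor_inj]
    exact LinearMap.rTensor_injective_of_lTensor_injective_s6 q.exact_subtype_ker_map hq hip hp
      (Module.Flat.rTensor_preserves_injective_linearMap _ (Submodule.subtype_injective _))
      (hV N fun x r ↦ hN r r.2 x)
end
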